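/- arXiv:2605.25146 — 7 statements merged into one kernel-verified Lean document; each statement's English description precedes it below -/
import Mathlib

section
/- Let {Π_{ik}} be a measurement design on ℂ^q that is α-unitary for some α ∈ ℝ. Then α is uniquely determined by q and the average number of distinct eigenvalues q̄ := (1/n) Σ_{i=1}^n q_i, namely α = ((q̄ − 1)/(q − 1)) · (1/(q + 1)). -/
open Matrix Finset

noncomputable section

/-- The Gram superoperator `G[S] = (1/n) Σ_i Σ_k (tr(S Π_{ik})/m_{ik}) Π_{ik}` of a
measurement design, where `m_{ik} = tr(Π_{ik})`. -/
def gramOf {q n : ℕ} (out : Fin n → ℕ)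
    (P : (i : Fin n) → Fin (out i) → Matrix (Fin q) (Fin q) ℂ)
    (S : Matrix (Fin q) (Fin q) ℂ) : Matrix (Fin q) (Fin q) ℂ :=
  (n : ℂ)⁻¹ • ∑ i, ∑ k, ((S * P i k).trace / (P i k).trace) • P i k

section Gram

variable {q n : ℕ} (out : Fin n → ℕ) (P : (i : Fin n) → Fin (out i) → Matrix (Fin q) (Fin q) ℂ)

lemma gramOf_add (S T : Matrix (Fin q) (Fin q) ℂ) :
    gramOf out P (S + T) = gramOf out P S + gramOf out P T := by
  simp only [gramOf, Matrix.add_mul, trace_add, add_div, add_smul, sum_add_distrib, smul_add]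

lemma gramOf_smul (c : ℂ) (S : Matrix (Fin q) (Fin q) ℂ) :
    gramOf out P (c • S) = c • gramOf out P S := by
  simp only [gramOf, Matrix.smul_mul, trace_smul, smul_eq_mul, mul_div_assoc, mul_smul,
    ← smul_sum]
  rw [smul_comm]

variable {out P}

/-- A design is unital: its Gram superoperator fixes the identity. -/
lemma gramOf_one (hn : n ≠ 0) (htr : ∀ i k, (P i k).trace ≠ 0) (hsum : ∀ i, ∑ k, P i k = 1) :
    gramOf out P 1 = 1 := by
  have hn' : (n : ℂ) ≠ 0 := Nat.cast_ne_zero.mpr hn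
  simp only [gramOf, Matrix.one_mul, div_self (htr _ _), one_smul, hsum]
  rw [sum_const, card_univ, Fintype.card_fin, ← Nat.cast_smul_eq_nsmul ℂ, smul_smul,
    inv_mul_cancel₀ hn', one_smul]

/-- The trace of the Gram superoperator is the average number of outcomes. -/
lemma sum_gramOf_single (htr : ∀ i k, (P i k).trace ≠ 0)
    (hproj : ∀ i k, P i k * P i k = P i k) :
    ∑ a, ∑ b, gramOf out P (Matrix.single a b 1) a b = (n : ℂ)⁻¹ * ∑ i, (out i : ℂ) := by
  have key : ∀ i k, ∑ a, ∑ b,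
      (Matrix.single a b 1 * P i k).trace / (P i k).trace * P i k a b = 1 := by
    intro i k
    have h : ∑ a, ∑ b, P i k a b * P i k b a = (P i k).trace := by
      conv_rhs => rw [← hproj i k]
      simp only [trace, diag_apply, Matrix.mul_apply]
    calc _ = (∑ a, ∑ b, P i k a b * P i k b a) / (P i k).trace := by
          simp only [sum_div, trace_single_mul, one_smul]
          exact sum_congr rfl fun a _ => sum_congr rfl fun b _ => by ring
      _ = 1 := by rw [h, div_self (htr i k)]
  have hout : ∀ i, (out i : ℂ) = ∑ k, ∑ a, ∑ b,
      (Matrix.single a b 1 * P i k).trace / (P i k).trace * P i k a b := by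
    simp [key]
  have sum_swap : ∀ f : (i : Fin n) → Fin (out i) → Fin q → Fin q → ℂ,
      ∑ a, ∑ b, ∑ i, ∑ k, f i k a b = ∑ i, ∑ k, ∑ a, ∑ b, f i k a b := by
    intro f
    calc _ = ∑ a, ∑ i, ∑ b, ∑ k, f i k a b := sum_congr rfl fun _ _ => sum_comm
      _ = ∑ i, ∑ a, ∑ b, ∑ k, f i k a b := sum_comm
      _ = ∑ i, ∑ a, ∑ k, ∑ b, f i k a b :=
        sum_congr rfl fun _ _ => sum_congr rfl fun _ _ => sum_comm
      _ = _ := sum_congr rfl fun _ _ => sum_comm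
  simp only [gramOf, Matrix.smul_apply, Matrix.sum_apply, smul_eq_mul, ← mul_sum, hout]
  congr 1
  exact sum_swap _

/-- By complex linearity, a relation `G[Δ] = α Δ` on traceless Hermitian matrices extends to all
traceless matrices. -/
lemma gramOf_eq_smul_of_trace_eq_zero {α : ℝ}
    (hunitary : ∀ Δ : Matrix (Fin q) (Fin q) ℂ, Δ.IsHermitian → Δ.trace = 0 →
      gramOf out P Δ = (α : ℂ) • Δ)
    {S : Matrix (Fin q) (Fin q) ℂ} (hS : S.trace = 0) : gramOf out P S = (α : ℂ) • S := by
  have hre := hunitary (S + Sᴴ) (isHermitian_add_transpose_self S)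
    (by simp [trace_conjTranspose, hS])
  have him := hunitary (Complex.I • (S - Sᴴ))
    (by simp [Matrix.IsHermitian, conjTranspose_smul, conjTranspose_sub, ← smul_neg])
    (by simp [trace_conjTranspose, hS])
  have hdec : S = (1 / 2 : ℂ) • (S + Sᴴ) + (-Complex.I / 2) • (Complex.I • (S - Sᴴ)) := by
    have hI : -Complex.I / 2 * Complex.I = 1 / 2 := by
      linear_combination (-1 / 2 : ℂ) * Complex.I_mul_I
    rw [smul_smul, hI]
    module
  calc gramOf out P S
      = (1 / 2 : ℂ) • ((α : ℂ) • (S + Sᴴ))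
          + (-Complex.I / 2) • ((α : ℂ) • (Complex.I • (S - Sᴴ))) := by
        conv_lhs => rw [hdec]
        rw [gramOf_add, gramOf_smul, gramOf_smul _ _ (-Complex.I / 2), hre, him]
    _ = (α : ℂ) • S := by
        conv_rhs => rw [hdec]
        module

end Gram

/-- If a measurement design on `ℂ^q` is `α`-unitary, then
`α = ((q̄ − 1)/(q − 1)) · (1/(q + 1))`, where `q̄ = (1/n) Σ_i q_i` is the average number of
distinct eigenvalues. -/
theorem alpha_unitary_constant_determined
    (q n : ℕ) (hq : 2 ≤ q) (hn : 1 ≤ n)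
    (out : Fin n → ℕ) (hout : ∀ i, 2 ≤ out i)
    (P : (i : Fin n) → Fin (out i) → Matrix (Fin q) (Fin q) ℂ)
    (hherm : ∀ i k, (P i k).IsHermitian)
    (hproj : ∀ i k, P i k * P i k = P i k)
    (horth : ∀ i (k k' : Fin (out i)), k ≠ k' → P i k * P i k' = 0)
    (hsum : ∀ i, ∑ k, P i k = 1)
    (hP0 : ∀ i k, P i k ≠ 0)
    (α : ℝ)
    (hunitary : ∀ Δ : Matrix (Fin q) (Fin q) ℂ, Δ.IsHermitian → Δ.trace = 0 →
        gramOf out P Δ = (α : ℂ) • Δ) :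
    α = (((∑ i, (out i : ℝ)) / n - 1) / ((q : ℝ) - 1)) * (1 / ((q : ℝ) + 1)) := by
  open scoped ComplexOrder in
  have htr : ∀ i k, (P i k).trace ≠ 0 := fun i k h => hP0 i k <| by
    rw [← trace_conjTranspose_mul_self_eq_zero_iff, (hherm i k).eq, hproj, h]
  have hq0 : (q : ℂ) ≠ 0 := by norm_cast; omega
  have hG : ∀ S : Matrix (Fin q) (Fin q) ℂ,
      gramOf out P S = (α : ℂ) • S + ((1 - α) * (S.trace / q)) • (1 : Matrix _ _ ℂ) := by
    intro S
    have hS := gramOf_eq_smul_of_trace_eq_zero hunitary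
      (S := S + (-(S.trace / q)) • (1 : Matrix _ _ ℂ)) (by
        rw [trace_add, trace_smul, trace_one, Fintype.card_fin, smul_eq_mul]
        field_simp
        ring)
    rw [gramOf_add, gramOf_smul, gramOf_one (by omega) htr hsum] at hS
    rw [eq_sub_of_add_eq hS]
    module
  have hentry : ∀ a b : Fin q, gramOf out P (Matrix.single a b 1) a b
      = α + if a = b then (1 - α : ℂ) / q else 0 := by
    intro a b
    rw [hG]
    by_cases hab : a = b
    · subst hab
      simp [div_eq_mul_inv]
    · simp [hab]
  have htrace := sum_gramOf_single htr hproj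
  simp only [hentry, sum_add_distrib, sum_ite_eq, mem_univ, if_true, sum_const, card_univ,
    Fintype.card_fin, nsmul_eq_mul, mul_div_cancel₀ _ hq0] at htrace
  have hreal : (q : ℝ) * (q * α) + (1 - α) = (n : ℝ)⁻¹ * ∑ i, (out i : ℝ) := by
    apply Complex.ofReal_injective
    push_cast
    exact htrace
  have hq2 : (2 : ℝ) ≤ q := by exact_mod_cast hq
  have h1 : (q : ℝ) - 1 ≠ 0 := by linarith
  have h2 : (q : ℝ) + 1 ≠ 0 := by linarith
  rw [div_eq_inv_mul _ (n : ℝ), ← hreal]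
  field_simp
  ring
end
end

section
/- Let q ≥ 2 and let {Π_{ik} : 1 ≤ i ≤ q+1, 1 ≤ k ≤ q} be rank-one Hermitian projections in ℂ^{q×q} such that Σ_{k=1}^{q} Π_{ik} = I_q for each i and tr(Π_{ik} Π_{i'k'}) = 1 if (i,k) = (i',k'), 0 if i = i' and k ≠ k', and 1/q if i ≠ i' (the mutually unbiased bases condition). Then this design is (1/(q+1))-unitary; equivalently, for every Hermitian S ∈ ℂ^{q×q}, (1/(q+1)) Σ_{i=1}^{q+1} Σ_{k=1}^{q} tr(S Π_{ik}) Π_{ik} = (1/(q+1)) S + (q/(q+1)) tr(S) (I_q/q). -/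
open Matrix Finset

noncomputable section

/-- Pairing a combination of mutually unbiased projections with one of them. -/
theorem trace_sum_smul_mul_mub {q : ℕ} {ι : Type*} [Fintype ι] [DecidableEq ι]
    {P : ι → Fin q → Matrix (Fin q) (Fin q) ℂ}
    (htr : ∀ i k i' k', (P i k * P i' k').trace =
      if i = i' then (if k = k' then 1 else 0) else (1 / q : ℂ))
    (c : ι → Fin q → ℂ) (j : ι) (l : Fin q) :
    ((∑ i, ∑ k, c i k • P i k) * P j l).trace =
      c j l + ∑ i ∈ univ.erase j, (∑ k, c i k) / q := by
  simp only [Finset.sum_mul, Matrix.trace_sum, smul_mul_assoc, Matrix.trace_smul, htr,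
    smul_eq_mul]
  rw [← Finset.add_sum_erase univ _ (mem_univ j)]
  congr 1
  · simp
  · refine Finset.sum_congr rfl fun i hi => ?_
    simp [Finset.ne_of_mem_erase hi, Finset.sum_mul, div_eq_mul_inv]

/-- A complete set of mutually unbiased bases spans the full matrix algebra. -/
theorem exists_eq_sum_smul_mub {q : ℕ} (hq : 0 < q)
    {P : Fin (q + 1) → Fin q → Matrix (Fin q) (Fin q) ℂ}
    (hsum : ∀ i, ∑ k, P i k = 1)
    (htr : ∀ i k i' k', (P i k * P i' k').trace =
      if i = i' then (if k = k' then 1 else 0) else (1 / q : ℂ))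
    (S : Matrix (Fin q) (Fin q) ℂ) :
    ∃ c : Fin (q + 1) → Fin q → ℂ, S = ∑ i, ∑ k, c i k • P i k := by
  let B : (Fin (q + 1) → Fin q → ℂ) →ₗ[ℂ] Matrix (Fin q) (Fin q) ℂ × (Fin q → ℂ) :=
    { toFun := fun c => (∑ i, ∑ k, c i k • P i k, fun i => c i.castSucc ⟨0, hq⟩)
      map_add' := fun c d => by
        ext <;> simp [add_smul, Finset.sum_add_distrib]
      map_smul' := fun a c => by
        ext <;> simp [mul_smul, Finset.smul_sum] }
  have hinj : Function.Injective B := by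
    rw [← LinearMap.ker_eq_bot, LinearMap.ker_eq_bot']
    intro c hc
    have hA : ∑ i, ∑ k, c i k • P i k = 0 := congrArg Prod.fst hc
    have h0 (i : Fin q) : c i.castSucc ⟨0, hq⟩ = 0 := congrFun (congrArg Prod.snd hc) i
    have hconst (j : Fin (q + 1)) (l : Fin q) : c j l = c j ⟨0, hq⟩ := by
      have h (l : Fin q) := trace_sum_smul_mul_mub htr c j l
      simp only [hA, zero_mul, Matrix.trace_zero] at h
      exact add_right_cancel ((h l).symm.trans (h ⟨0, hq⟩))
    have hlast : c (Fin.last q) ⟨0, hq⟩ = 0 := by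
      have h : ∑ i, c i ⟨0, hq⟩ • (1 : Matrix (Fin q) (Fin q) ℂ) = 0 := by
        rw [← hA]
        refine Finset.sum_congr rfl fun i _ => ?_
        rw [← hsum i, Finset.smul_sum]
        exact Finset.sum_congr rfl fun k _ => by rw [hconst i k]
      rw [Fin.sum_univ_castSucc] at h
      simpa [h0] using congrFun (congrFun h ⟨0, hq⟩) ⟨0, hq⟩
    ext j l
    rw [hconst]
    refine Fin.lastCases ?_ (fun i => ?_) j
    · exact hlast
    · exact h0 i
  have hdim : Module.finrank ℂ (Fin (q + 1) → Fin q → ℂ) =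
      Module.finrank ℂ (Matrix (Fin q) (Fin q) ℂ × (Fin q → ℂ)) := by
    simp [Module.finrank_pi_fintype, Module.finrank_matrix]
    ring
  obtain ⟨c, hc⟩ := (LinearMap.injective_iff_surjective_of_finrank_eq_finrank hdim).mp hinj (S, 0)
  exact ⟨c, (congrArg Prod.fst hc).symm⟩

/-- The frame operator of a complete set of mutually unbiased bases. -/
theorem sum_trace_smul_mub {q : ℕ} (hq : 0 < q)
    {P : Fin (q + 1) → Fin q → Matrix (Fin q) (Fin q) ℂ}
    (hproj : ∀ i k, P i k * P i k = P i k)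
    (hsum : ∀ i, ∑ k, P i k = 1)
    (htr : ∀ i k i' k', (P i k * P i' k').trace =
      if i = i' then (if k = k' then 1 else 0) else (1 / q : ℂ))
    (S : Matrix (Fin q) (Fin q) ℂ) :
    ∑ i, ∑ k, (S * P i k).trace • P i k = S + S.trace • 1 := by
  obtain ⟨c, rfl⟩ := exists_eq_sum_smul_mub hq hsum htr S
  have hq0 : (q : ℂ) ≠ 0 := by exact_mod_cast hq.ne'
  have htrace : (∑ i, ∑ k, c i k • P i k).trace = ∑ i, ∑ k, c i k := by
    have h (i k) : (P i k).trace = 1 := by simpa [hproj] using htr i k i k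
    simp [Matrix.trace_sum, h]
  simp only [trace_sum_smul_mul_mub htr, htrace, add_smul, Finset.sum_add_distrib,
    ← Finset.smul_sum, hsum]
  congr 1
  rw [← Finset.sum_smul]
  congr 1
  simp only [Finset.sum_erase_eq_sub (mem_univ _), Finset.sum_sub_distrib, ← Finset.sum_div,
    Finset.sum_const, card_univ, Fintype.card_fin, nsmul_eq_mul]
  push_cast
  field_simp
  ring

/-- A complete set of mutually unbiased bases (`q+1` bases of rank-one
projections with pairwise trace overlaps `1/q`) forms a `(1/(q+1))`-unitary design;
equivalently, for every Hermitian `S`,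
`(1/(q+1)) Σ_i Σ_k tr(S Π_{ik}) Π_{ik} = (1/(q+1)) S + (q/(q+1)) tr(S) (I_q/q)`. -/
theorem mub_is_unitary_design
    (q : ℕ) (hq : 2 ≤ q)
    (P : Fin (q + 1) → Fin q → Matrix (Fin q) (Fin q) ℂ)
    (hherm : ∀ i k, (P i k).IsHermitian)
    (hproj : ∀ i k, P i k * P i k = P i k)
    (hrank : ∀ i k, (P i k).rank = 1)
    (hsum : ∀ i, ∑ k, P i k = 1)
    (htr : ∀ i k i' k', (P i k * P i' k').trace =
      if i = i' then (if k = k' then 1 else 0) else (1 / q : ℂ)) :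
    (∀ Δ : Matrix (Fin q) (Fin q) ℂ, Δ.IsHermitian → Δ.trace = 0 →
        gramOf (fun _ : Fin (q + 1) => q) P Δ = (((q : ℂ) + 1)⁻¹ : ℂ) • Δ)
    ∧
    (∀ S : Matrix (Fin q) (Fin q) ℂ, S.IsHermitian →
      ((q : ℂ) + 1)⁻¹ • ∑ i, ∑ k, (S * P i k).trace • P i k
        = ((q : ℂ) + 1)⁻¹ • S
          + ((q : ℂ) / ((q : ℂ) + 1)) • S.trace • (q : ℂ)⁻¹ • (1 : Matrix (Fin q) (Fin q) ℂ)) := by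
  have hq0 : (q : ℂ) ≠ 0 := by
    exact_mod_cast (by omega : q ≠ 0)
  have hframe := sum_trace_smul_mub (by omega) hproj hsum htr
  refine ⟨fun Δ _ hΔ => ?_, fun S _ => ?_⟩
  · have h (i k) : (P i k).trace = 1 := by simpa [hproj] using htr i k i k
    simp [gramOf, h, hframe, hΔ]
  · rw [hframe, smul_add, smul_smul, smul_smul, smul_smul]
    congr 2
    field_simp
end
end

section
/- Let n ≥ 1 and, for i = 1,…,n, let O_i = w_i I_2 + v_i·σ⃗ ∈ ℂ^{2×2} with w_i ∈ ℝ and v_i ∈ ℝ³ \ {0}, and set u_i = v_i/‖v_i‖ ∈ S². Each O_i has the two eigenprojections Π_{i,±} = (I_2 ± u_i·σ⃗)/2, which form a measurement design on ℂ². Then: (1) the Gram superoperator G of this design satisfies G[a·σ⃗] = ((1/n) Σ_{i=1}^n u_i u_iᵀ a)·σ⃗ for every a ∈ ℝ³; (2) the design is complete if and only if span{v_1,…,v_n} = ℝ³; (3) for α ∈ ℝ, the design is α-unitary if and only if α = 1/3 and (1/n) Σ_{i=1}^n u_i u_iᵀ = (1/3) I_3. -/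
open Matrix Finset

noncomputable section

/-- The Pauli matrix `σ_x`. -/
def sigmaX : Matrix (Fin 2) (Fin 2) ℂ := !![0, 1; 1, 0]

/-- The Pauli matrix `σ_y`. -/
def sigmaY : Matrix (Fin 2) (Fin 2) ℂ := !![0, -Complex.I; Complex.I, 0]

/-- The Pauli matrix `σ_z`. -/
def sigmaZ : Matrix (Fin 2) (Fin 2) ℂ := !![1, 0; 0, -1]

/-- `a·σ⃗ = a₁ σ_x + a₂ σ_y + a₃ σ_z` for `a ∈ ℝ³`. -/
def dotPauli (a : Fin 3 → ℝ) : Matrix (Fin 2) (Fin 2) ℂ :=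
  a 0 • sigmaX + a 1 • sigmaY + a 2 • sigmaZ

/-- The Euclidean norm on `ℝ³`. -/
def enorm3 (a : Fin 3 → ℝ) : ℝ := Real.sqrt (∑ j, (a j) ^ 2)

/-- The map `a ↦ a·σ⃗` as a real-linear map. -/
def dotPauliLinear : (Fin 3 → ℝ) →ₗ[ℝ] Matrix (Fin 2) (Fin 2) ℂ where
  toFun := dotPauli
  map_add' a b := by simp only [dotPauli, Pi.add_apply, add_smul]; abel
  map_smul' r a := by simp [dotPauli, smul_add, mul_smul]

lemma dotPauliLinear_apply (a : Fin 3 → ℝ) : dotPauliLinear a = dotPauli a := rfl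

lemma dotPauli_eq (a : Fin 3 → ℝ) :
    dotPauli a = !![(a 2 : ℂ), a 0 - a 1 * Complex.I; a 0 + a 1 * Complex.I, -a 2] := by
  ext i j
  fin_cases i <;> fin_cases j <;>
    simp [dotPauli, sigmaX, sigmaY, sigmaZ, sub_eq_add_neg]

lemma dotPauli_injective : Function.Injective dotPauli := by
  intro a b h
  rw [dotPauli_eq, dotPauli_eq] at h
  have h₂ := congrArg Complex.re (congrFun (congrFun h 0) 0)
  have h₀ := congrArg Complex.re (congrFun (congrFun h 1) 0)
  have h₁ := congrArg Complex.im (congrFun (congrFun h 1) 0)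
  simp at h₀ h₁ h₂
  ext j
  fin_cases j <;> assumption

lemma isHermitian_dotPauli (a : Fin 3 → ℝ) : (dotPauli a).IsHermitian := by
  rw [dotPauli_eq]
  ext i j
  fin_cases i <;> fin_cases j <;> simp [sub_eq_add_neg]

lemma trace_dotPauli (a : Fin 3 → ℝ) : (dotPauli a).trace = 0 := by
  simp [dotPauli_eq, Matrix.trace_fin_two]

lemma trace_dotPauli_mul_dotPauli (a b : Fin 3 → ℝ) :
    (dotPauli a * dotPauli b).trace = 2 * ((b ⬝ᵥ a : ℝ) : ℂ) := by
  simp only [dotPauli_eq, Matrix.trace_fin_two, Matrix.mul_fin_two, dotProduct, Fin.sum_univ_three]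
  simp
  linear_combination (-2 * (a 1 : ℂ) * b 1) * Complex.I_sq

lemma Matrix.IsHermitian.exists_eq_dotPauli {Δ : Matrix (Fin 2) (Fin 2) ℂ}
    (hΔ : Δ.IsHermitian) (ht : Δ.trace = 0) : ∃ a, Δ = dotPauli a := by
  refine ⟨![(Δ 1 0).re, (Δ 1 0).im, (Δ 0 0).re], ?_⟩
  rw [Matrix.trace_fin_two] at ht
  have h₀₀ := hΔ.apply 0 0
  have h₀₁ := hΔ.apply 0 1
  rw [dotPauli_eq]
  have h : ((Δ 0 0).re : ℂ) = Δ 0 0 := Complex.conj_eq_iff_re.mp h₀₀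
  ext i j
  fin_cases i <;> fin_cases j
  · simp [h]
  · simp [← h₀₁, Complex.ext_iff]
  · simp [Complex.re_add_im]
  · simp [h]
    linear_combination ht

/-- The projection `(I + ε u·σ⃗)/2` tested against `a·σ⃗`, where `ε = 1` for outcome `0`
and `ε = -1` otherwise. -/
lemma trace_dotPauli_mul_projection (a u : Fin 3 → ℝ) (ε : ℝ) :
    (dotPauli a * ((2 : ℂ)⁻¹ • ((1 : Matrix (Fin 2) (Fin 2) ℂ) + ε • dotPauli u))).trace
      = ((ε * (u ⬝ᵥ a) : ℝ) : ℂ) := by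
  rw [Matrix.mul_smul, mul_add, mul_one, Matrix.mul_smul, Matrix.trace_smul, Matrix.trace_add,
    Matrix.trace_smul, trace_dotPauli, trace_dotPauli_mul_dotPauli]
  simp
  ring

lemma sum_trace_smul_projection (a u : Fin 3 → ℝ) (P : Fin 2 → Matrix (Fin 2) (Fin 2) ℂ)
    (hP : ∀ s, P s = (2 : ℂ)⁻¹ •
      ((1 : Matrix (Fin 2) (Fin 2) ℂ) + (if s = 0 then (1 : ℝ) else -1) • dotPauli u)) :
    ∑ s, (dotPauli a * P s).trace • P s = dotPauli ((u ⬝ᵥ a) • u) := by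
  simp only [hP, trace_dotPauli_mul_projection, Fin.sum_univ_two]
  rw [← dotPauliLinear_apply ((u ⬝ᵥ a) • u), map_smul, dotPauliLinear_apply]
  ext i j
  simp
  ring

lemma span_range_eq_top_iff_dotProduct {ι m K : Type*} [Fintype m] [Field K]
    (v : ι → m → K) :
    Submodule.span K (Set.range v) = ⊤ ↔ ∀ a : m → K, (∀ i, v i ⬝ᵥ a = 0) → a = 0 := by
  classical
  constructor
  · intro h a ha
    have key : ∀ x, x ⬝ᵥ a = 0 := by
      intro x
      have hx : x ∈ Submodule.span K (Set.range v) := h ▸ Submodule.mem_top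
      induction hx using Submodule.span_induction with
      | mem x hx => obtain ⟨i, rfl⟩ := hx; exact ha i
      | zero => simp
      | add x y _ _ hx hy => rw [add_dotProduct, hx, hy, add_zero]
      | smul c x _ hx => rw [smul_dotProduct, hx, smul_zero]
    ext j
    simpa using key (Pi.single j 1)
  · intro h
    by_contra hne
    obtain ⟨f, hf, hle⟩ := Submodule.exists_le_ker_of_lt_top _ (lt_top_iff_ne_top.mpr hne)
    have key : ∀ x, x ⬝ᵥ (fun j => f (Pi.single j 1)) = f x := by
      intro x
      conv_rhs => rw [pi_eq_sum_univ' x, map_sum]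
      refine Finset.sum_congr rfl fun j _ => ?_
      rw [map_smul, smul_eq_mul]
    have h0 := h (fun j => f (Pi.single j 1)) fun i => by
      rw [key]
      exact hle (Submodule.subset_span ⟨i, rfl⟩)
    exact hf (LinearMap.ext fun x => by rw [← key, h0]; simp)

lemma sum_sq_eq_dotProduct (a : Fin 3 → ℝ) : ∑ j, (a j) ^ 2 = a ⬝ᵥ a := by
  simp [dotProduct, sq]

lemma enorm3_ne_zero {a : Fin 3 → ℝ} (ha : a ≠ 0) : enorm3 a ≠ 0 := by
  have hnn : 0 ≤ ∑ j, (a j) ^ 2 := Finset.sum_nonneg fun j _ => sq_nonneg _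
  rw [enorm3, Ne, Real.sqrt_eq_zero hnn, sum_sq_eq_dotProduct, dotProduct_self_eq_zero]
  exact ha

lemma dotProduct_self_normalized {a : Fin 3 → ℝ} (ha : a ≠ 0) :
    ((enorm3 a)⁻¹ • a) ⬝ᵥ ((enorm3 a)⁻¹ • a) = 1 := by
  have hsq : enorm3 a ^ 2 = a ⬝ᵥ a := by
    rw [enorm3, Real.sq_sqrt (Finset.sum_nonneg fun j _ => sq_nonneg _), sum_sq_eq_dotProduct]
  have := enorm3_ne_zero ha
  rw [smul_dotProduct, dotProduct_smul, ← hsq, smul_eq_mul, smul_eq_mul]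
  field_simp

lemma frame_mulVec {n : ℕ} (u : Fin n → Fin 3 → ℝ) (a : Fin 3 → ℝ) :
    ((n : ℝ)⁻¹ • ∑ i, Matrix.of (fun b c : Fin 3 => u i b * u i c)) *ᵥ a
      = (n : ℝ)⁻¹ • ∑ i, (u i ⬝ᵥ a) • u i := by
  rw [Matrix.smul_mulVec, Matrix.sum_mulVec]
  congr 1
  refine Finset.sum_congr rfl fun i _ => ?_
  ext b
  simp only [Matrix.mulVec, dotProduct, Matrix.of_apply, Pi.smul_apply, smul_eq_mul,
    Finset.sum_mul]
  exact Finset.sum_congr rfl fun c _ => by ring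

lemma trace_frame {n : ℕ} (hn : 1 ≤ n) (u : Fin n → Fin 3 → ℝ) (hu : ∀ i, u i ⬝ᵥ u i = 1) :
    ((n : ℝ)⁻¹ • ∑ i, Matrix.of (fun b c : Fin 3 => u i b * u i c)).trace = 1 := by
  have h : ∀ i, (Matrix.of (fun b c : Fin 3 => u i b * u i c)).trace = 1 := hu
  have hn' : (n : ℝ) ≠ 0 := by positivity
  simp [Matrix.trace_smul, Matrix.trace_sum, h, hn']

/-- For qubit observables `O_i = w_i I₂ + v_i·σ⃗` with Bloch directions
`u_i = v_i/‖v_i‖` and eigenprojections `Π_{i,±} = (I₂ ± u_i·σ⃗)/2`: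
(1) the Gram superoperator acts on traceless Hermitians by `a·σ⃗ ↦ ((1/n) Σ_i u_i u_iᵀ a)·σ⃗`;
(2) the design is complete iff `span{v_i} = ℝ³`;
(3) it is `α`-unitary iff `α = 1/3` and `(1/n) Σ_i u_i u_iᵀ = (1/3) I₃`. -/
theorem qubit_design_gram_complete_unitary
    (n : ℕ) (hn : 1 ≤ n)
    (w : Fin n → ℝ) (v : Fin n → Fin 3 → ℝ) (hv : ∀ i, v i ≠ 0)
    (O : Fin n → Matrix (Fin 2) (Fin 2) ℂ)
    (hO : ∀ i, O i = w i • (1 : Matrix (Fin 2) (Fin 2) ℂ) + dotPauli (v i))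
    (u : Fin n → Fin 3 → ℝ) (hu : ∀ i, u i = (enorm3 (v i))⁻¹ • v i)
    (Pr : Fin n → Fin 2 → Matrix (Fin 2) (Fin 2) ℂ)
    (hPr : ∀ i s, Pr i s = (2 : ℂ)⁻¹ •
      ((1 : Matrix (Fin 2) (Fin 2) ℂ) + (if s = 0 then (1 : ℝ) else -1) • dotPauli (u i))) :
    (∀ a : Fin 3 → ℝ,
      (n : ℂ)⁻¹ • ∑ i, ∑ s, (dotPauli a * Pr i s).trace • Pr i s
        = dotPauli (Matrix.mulVec
            ((n : ℝ)⁻¹ • ∑ i, Matrix.of (fun b c : Fin 3 => u i b * u i c)) a))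
    ∧
    ((∀ Δ : Matrix (Fin 2) (Fin 2) ℂ, Δ.IsHermitian → Δ.trace = 0 →
        (∀ i s, (Δ * Pr i s).trace = 0) → Δ = 0)
      ↔ Submodule.span ℝ (Set.range v) = ⊤)
    ∧
    (∀ α : ℝ,
      (∀ Δ : Matrix (Fin 2) (Fin 2) ℂ, Δ.IsHermitian → Δ.trace = 0 →
        (n : ℂ)⁻¹ • ∑ i, ∑ s, (Δ * Pr i s).trace • Pr i s = (α : ℂ) • Δ)
      ↔ (α = 1 / 3 ∧
          (n : ℝ)⁻¹ • ∑ i, Matrix.of (fun b c : Fin 3 => u i b * u i c)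
            = (3 : ℝ)⁻¹ • (1 : Matrix (Fin 3) (Fin 3) ℝ))) := by
  have hu1 : ∀ i, u i ⬝ᵥ u i = 1 := fun i => by
    rw [hu]; exact dotProduct_self_normalized (hv i)
  have gram : ∀ a : Fin 3 → ℝ,
      (n : ℂ)⁻¹ • ∑ i, ∑ s, (dotPauli a * Pr i s).trace • Pr i s
        = dotPauli (Matrix.mulVec
            ((n : ℝ)⁻¹ • ∑ i, Matrix.of (fun b c : Fin 3 => u i b * u i c)) a) := by
    intro a
    rw [Finset.sum_congr rfl fun i _ => sum_trace_smul_projection a (u i) (Pr i) (hPr i),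
      frame_mulVec]
    simp only [← dotPauliLinear_apply, map_smul, map_sum]
    rw [← Complex.coe_smul]
    simp
  refine ⟨gram, ?_, fun α => ?_⟩
  · have horth : ∀ a, (∀ i s, (dotPauli a * Pr i s).trace = 0) ↔ ∀ i, v i ⬝ᵥ a = 0 := by
      intro a
      refine forall_congr' fun i => ?_
      simp only [hPr, trace_dotPauli_mul_projection, hu, smul_dotProduct, Fin.forall_fin_two]
      simp [enorm3_ne_zero (hv i)]
    rw [span_range_eq_top_iff_dotProduct]
    have h0 : dotPauli 0 = 0 := dotPauliLinear.map_zero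
    constructor
    · intro h a ha
      exact dotPauli_injective <| (h _ (isHermitian_dotPauli a) (trace_dotPauli a)
        ((horth a).mpr ha)).trans h0.symm
    · intro h Δ hΔ ht htr
      obtain ⟨a, rfl⟩ := hΔ.exists_eq_dotPauli ht
      rw [h a ((horth a).mp htr), h0]
  · have hα : ∀ a, (α : ℂ) • dotPauli a = dotPauli (α • a) := fun a => by
      rw [Complex.coe_smul, ← dotPauliLinear_apply, ← map_smul, dotPauliLinear_apply]
    have htr := trace_frame hn u hu1
    constructor
    · intro h
      have hM : (n : ℝ)⁻¹ • ∑ i, Matrix.of (fun b c : Fin 3 => u i b * u i c)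
          = α • (1 : Matrix (Fin 3) (Fin 3) ℝ) := by
        refine Matrix.ext_of_mulVec_single fun j => ?_
        refine dotPauli_injective ?_
        rw [← gram, h _ (isHermitian_dotPauli _) (trace_dotPauli _), hα, Matrix.smul_mulVec,
          Matrix.one_mulVec]
      have hα3 : α = 1 / 3 := by
        rw [hM] at htr
        simp at htr
        linarith
      exact ⟨hα3, by rw [hM, hα3, one_div]⟩
    · rintro ⟨rfl, hM⟩ Δ hΔ ht
      obtain ⟨a, rfl⟩ := hΔ.exists_eq_dotPauli ht
      rw [gram, hM, hα, Matrix.smul_mulVec, Matrix.one_mulVec, one_div]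
end
end

section
/- Let {Π_{ik}} be a measurement design on ℂ^q and let p_{ik} ∈ ℝ (1 ≤ i ≤ n, 1 ≤ k ≤ q_i) satisfy Σ_{k=1}^{q_i} p_{ik} = 1 for each i. Define Loss[S] := Σ_{i=1}^n Σ_{k=1}^{q_i} (tr(S Π_{ik}) − p_{ik})²/m_{ik} for Hermitian S. Then: (1) a Hermitian matrix S minimizes Loss over all Hermitian matrices of trace 1 if and only if it satisfies the normal equation Σ_{i,k} (tr(S Π_{ik})/m_{ik}) Π_{ik} = Σ_{i,k} (p_{ik}/m_{ik}) Π_{ik}, and every Hermitian solution of this normal equation automatically has trace 1; (2) the set of minimizers is an affine coset S₀ + N, where S₀ is any minimizer and N = {Δ Hermitian : tr(Δ Π_{ik}) = 0 for all i,k}; (3) if the design is complete, the minimizer is unique and equals (nG)^{-1}[Σ_{i,k} (p_{ik}/m_{ik}) Π_{ik}], where G is the Gram superoperator. -/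
open Matrix Finset

noncomputable section

/-- The least-squares loss `Loss[S] = Σ_{i,k} (tr(S Π_{ik}) − p_{ik})²/m_{ik}`. -/
def lossOf {q n : ℕ} (out : Fin n → ℕ)
    (P : (i : Fin n) → Fin (out i) → Matrix (Fin q) (Fin q) ℂ)
    (p : (i : Fin n) → Fin (out i) → ℝ)
    (S : Matrix (Fin q) (Fin q) ℂ) : ℝ :=
  ∑ i, ∑ k, ((S * P i k).trace.re - p i k) ^ 2 / (P i k).trace.re

/-- The normal equation `Σ_{i,k} (tr(S Π_{ik})/m_{ik}) Π_{ik} = Σ_{i,k} (p_{ik}/m_{ik}) Π_{ik}`. -/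
def normalEq {q n : ℕ} (out : Fin n → ℕ)
    (P : (i : Fin n) → Fin (out i) → Matrix (Fin q) (Fin q) ℂ)
    (p : (i : Fin n) → Fin (out i) → ℝ)
    (S : Matrix (Fin q) (Fin q) ℂ) : Prop :=
  ∑ i, ∑ k, ((S * P i k).trace / (P i k).trace) • P i k
    = ∑ i, ∑ k, ((p i k : ℂ) / (P i k).trace) • P i k

/-- The real part of the trace pairing, as a real-linear form in the left factor. -/
def reTraceMul {q : ℕ} (A : Matrix (Fin q) (Fin q) ℂ) : Matrix (Fin q) (Fin q) ℂ →ₗ[ℝ] ℝ where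
  toFun S := (S * A).trace.re
  map_add' S T := by simp [add_mul]
  map_smul' c S := by simp

/-- The matrix `Σ_{i,k} (c_{ik}/m_{ik}) Π_{ik}` with real coefficients `c`. -/
def weightedSum {q n : ℕ} {out : Fin n → ℕ}
    (P : (i : Fin n) → Fin (out i) → Matrix (Fin q) (Fin q) ℂ)
    (c : (i : Fin n) → Fin (out i) → ℝ) : Matrix (Fin q) (Fin q) ℂ :=
  ∑ i, ∑ k, (c i k / (P i k).trace.re) • P i k

/-- The unnormalized Gram superoperator `nG`, as a real-linear map. -/
def gramSum {q n : ℕ} {out : Fin n → ℕ}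
    (P : (i : Fin n) → Fin (out i) → Matrix (Fin q) (Fin q) ℂ) :
    Matrix (Fin q) (Fin q) ℂ →ₗ[ℝ] Matrix (Fin q) (Fin q) ℂ where
  toFun S := weightedSum P fun i k => reTraceMul (P i k) S
  map_add' S T := by
    simp only [weightedSum, map_add, add_div, add_smul, Finset.sum_add_distrib]
  map_smul' c S := by
    simp only [weightedSum, map_smul, smul_eq_mul, mul_div_assoc, mul_smul, Finset.smul_sum,
      RingHom.id_apply]

section

variable {q n : ℕ} {out : Fin n → ℕ}
  {P : (i : Fin n) → Fin (out i) → Matrix (Fin q) (Fin q) ℂ}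

theorem ofReal_re_trace_mul {A B : Matrix (Fin q) (Fin q) ℂ}
    (hA : A.IsHermitian) (hB : B.IsHermitian) :
    (((A * B).trace.re : ℝ) : ℂ) = (A * B).trace := by
  apply Complex.conj_eq_iff_re.mp
  have h := Matrix.trace_conjTranspose (A * B)
  rw [Matrix.conjTranspose_mul, hA.eq, hB.eq, Matrix.trace_mul_comm] at h
  exact h.symm

theorem ofReal_re_trace {A : Matrix (Fin q) (Fin q) ℂ} (hA : A.IsHermitian) :
    ((A.trace.re : ℝ) : ℂ) = A.trace := by
  simpa using ofReal_re_trace_mul hA Matrix.isHermitian_one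

open scoped ComplexOrder in
theorem eq_zero_of_re_trace_mul_self {A : Matrix (Fin q) (Fin q) ℂ} (hA : A.IsHermitian)
    (h : (A * A).trace.re = 0) : A = 0 := by
  have h0 : (A * A).trace = 0 := by rw [← ofReal_re_trace_mul hA hA, h, Complex.ofReal_zero]
  apply Matrix.trace_conjTranspose_mul_self_eq_zero_iff.mp
  rwa [hA.eq]

open scoped ComplexOrder in
theorem re_trace_pos {A : Matrix (Fin q) (Fin q) ℂ} (hA : A.IsHermitian) (hAA : A * A = A)
    (h0 : A ≠ 0) : 0 < A.trace.re := by
  have hpsd : A.PosSemidef := by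
    have h := Matrix.posSemidef_conjTranspose_mul_self A
    rwa [hA.eq, hAA] at h
  have hnn : 0 ≤ A.trace.re := (Complex.le_def.mp hpsd.trace_nonneg).1
  refine lt_of_le_of_ne hnn fun h => h0 (eq_zero_of_re_trace_mul_self hA ?_)
  rw [hAA, ← h]

theorem isHermitian_weightedSum (hP : ∀ i k, (P i k).IsHermitian)
    (c : (i : Fin n) → Fin (out i) → ℝ) : (weightedSum P c).IsHermitian := by
  simp only [Matrix.IsHermitian, weightedSum, Matrix.conjTranspose_sum,
    Matrix.conjTranspose_smul, (hP _ _).eq, star_trivial]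

theorem re_trace_mul_weightedSum (c : (i : Fin n) → Fin (out i) → ℝ)
    (Δ : Matrix (Fin q) (Fin q) ℂ) :
    (Δ * weightedSum P c).trace.re = ∑ i, ∑ k, reTraceMul (P i k) Δ * c i k / (P i k).trace.re := by
  simp only [weightedSum, Finset.mul_sum, Matrix.trace_sum, Complex.re_sum, Matrix.mul_smul,
    Matrix.trace_smul, Complex.smul_re, smul_eq_mul]
  refine Finset.sum_congr rfl fun i _ => Finset.sum_congr rfl fun k _ => ?_
  change _ * reTraceMul (P i k) Δ = _
  ring

theorem re_trace_weightedSum (hpos : ∀ i k, 0 < (P i k).trace.re)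
    (c : (i : Fin n) → Fin (out i) → ℝ) :
    (weightedSum P c).trace.re = ∑ i, ∑ k, c i k := by
  have h := re_trace_mul_weightedSum (P := P) c 1
  rw [one_mul] at h
  rw [h]
  refine Finset.sum_congr rfl fun i _ => Finset.sum_congr rfl fun k _ => ?_
  have hne := (hpos i k).ne'
  simp only [reTraceMul, LinearMap.coe_mk, AddHom.coe_mk, one_mul]
  field_simp

theorem sum_reTraceMul (hsum : ∀ i, ∑ k, P i k = 1) (i : Fin n)
    (S : Matrix (Fin q) (Fin q) ℂ) : ∑ k, reTraceMul (P i k) S = S.trace.re := by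
  simp only [reTraceMul, LinearMap.coe_mk, AddHom.coe_mk]
  rw [← Complex.re_sum, ← Matrix.trace_sum, ← Finset.mul_sum, hsum, mul_one]

theorem normalEq_iff_gramSum (hP : ∀ i k, (P i k).IsHermitian)
    (p : (i : Fin n) → Fin (out i) → ℝ) {S : Matrix (Fin q) (Fin q) ℂ} (hS : S.IsHermitian) :
    normalEq out P p S ↔ gramSum P S = weightedSum P p := by
  have key : ∀ (x : ℝ) i k, ((x : ℂ) / (P i k).trace) • P i k
      = (x / (P i k).trace.re) • P i k := by
    intro x i k
    rw [← ofReal_re_trace (hP i k), ← Complex.ofReal_div, Complex.ofReal_re]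
    exact Complex.coe_smul _ _
  have hl : ∑ i, ∑ k, ((S * P i k).trace / (P i k).trace) • P i k = gramSum P S := by
    refine Finset.sum_congr rfl fun i _ => Finset.sum_congr rfl fun k _ => ?_
    rw [← ofReal_re_trace_mul hS (hP i k), key]
    rfl
  have hr : ∑ i, ∑ k, ((p i k : ℂ) / (P i k).trace) • P i k = weightedSum P p := by
    refine Finset.sum_congr rfl fun i _ => Finset.sum_congr rfl fun k _ => ?_
    exact key _ i k
  rw [normalEq, hl, hr]

theorem lossOf_add (p : (i : Fin n) → Fin (out i) → ℝ) (S Δ : Matrix (Fin q) (Fin q) ℂ) :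
    lossOf out P p (S + Δ) = lossOf out P p S
      + 2 * (Δ * (gramSum P S - weightedSum P p)).trace.re
      + ∑ i, ∑ k, reTraceMul (P i k) Δ ^ 2 / (P i k).trace.re := by
  have h : (Δ * gramSum P S).trace.re
      = ∑ i, ∑ k, reTraceMul (P i k) Δ * reTraceMul (P i k) S / (P i k).trace.re :=
    re_trace_mul_weightedSum _ Δ
  rw [mul_sub, Matrix.trace_sub, Complex.sub_re, h, re_trace_mul_weightedSum]
  simp only [lossOf, ← Finset.sum_sub_distrib, Finset.mul_sum, ← Finset.sum_add_distrib]
  refine Finset.sum_congr rfl fun i _ => Finset.sum_congr rfl fun k _ => ?_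
  have ha : ((S + Δ) * P i k).trace.re = reTraceMul (P i k) S + reTraceMul (P i k) Δ :=
    map_add (reTraceMul (P i k)) S Δ
  have hs : (S * P i k).trace.re = reTraceMul (P i k) S := rfl
  rw [ha, hs]
  ring

theorem reTraceMul_eq_zero_of_gramSum_eq_zero (hpos : ∀ i k, 0 < (P i k).trace.re)
    {Δ : Matrix (Fin q) (Fin q) ℂ} (h : gramSum P Δ = 0) (i : Fin n) (k : Fin (out i)) :
    reTraceMul (P i k) Δ = 0 := by
  have h0 : (Δ * gramSum P Δ).trace.re
      = ∑ i, ∑ k, reTraceMul (P i k) Δ * reTraceMul (P i k) Δ / (P i k).trace.re :=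
    re_trace_mul_weightedSum _ Δ
  have hnn : ∀ i k, 0 ≤ reTraceMul (P i k) Δ * reTraceMul (P i k) Δ / (P i k).trace.re :=
    fun i k => div_nonneg (mul_self_nonneg _) (hpos i k).le
  rw [h, mul_zero, Matrix.trace_zero, Complex.zero_re, eq_comm,
    Finset.sum_eq_zero_iff_of_nonneg fun i _ => Finset.sum_nonneg fun k _ => hnn i k] at h0
  have h1 := (Finset.sum_eq_zero_iff_of_nonneg fun k _ => hnn i k).mp (h0 i (mem_univ i)) k
    (mem_univ k)
  simpa [(hpos i k).ne'] using h1

theorem gramSum_eq_zero_iff (hP : ∀ i k, (P i k).IsHermitian)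
    (hpos : ∀ i k, 0 < (P i k).trace.re)
    {Δ : Matrix (Fin q) (Fin q) ℂ} (hΔ : Δ.IsHermitian) :
    gramSum P Δ = 0 ↔ ∀ i k, (Δ * P i k).trace = 0 := by
  constructor
  · intro h i k
    rw [← ofReal_re_trace_mul hΔ (hP i k), Complex.ofReal_eq_zero]
    exact reTraceMul_eq_zero_of_gramSum_eq_zero hpos h i k
  · intro h
    change weightedSum P (fun i k => reTraceMul (P i k) Δ) = 0
    simp [weightedSum, reTraceMul, h]

theorem trace_eq_one_of_gramSum_eq (hn : 1 ≤ n) (hpos : ∀ i k, 0 < (P i k).trace.re)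
    (hsum : ∀ i, ∑ k, P i k = 1)
    {p : (i : Fin n) → Fin (out i) → ℝ} (hp : ∀ i, ∑ k, p i k = 1)
    {S : Matrix (Fin q) (Fin q) ℂ} (hS : S.IsHermitian) (h : gramSum P S = weightedSum P p) :
    S.trace = 1 := by
  have h1 : (gramSum P S).trace.re = ∑ i, ∑ k, reTraceMul (P i k) S := re_trace_weightedSum hpos _
  rw [h, re_trace_weightedSum hpos] at h1
  simp only [hp, sum_reTraceMul hsum, Finset.sum_const, Finset.card_univ, Fintype.card_fin,
    nsmul_eq_mul] at h1
  have hn' : (n : ℝ) ≠ 0 := by positivity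
  rw [← ofReal_re_trace hS, ← mul_left_cancel₀ hn' h1, Complex.ofReal_one]

theorem isMinimizer_iff_gramSum_eq (hn : 1 ≤ n) (hP : ∀ i k, (P i k).IsHermitian)
    (hpos : ∀ i k, 0 < (P i k).trace.re) (hsum : ∀ i, ∑ k, P i k = 1)
    {p : (i : Fin n) → Fin (out i) → ℝ} (hp : ∀ i, ∑ k, p i k = 1)
    {S : Matrix (Fin q) (Fin q) ℂ} (hS : S.IsHermitian) :
    (S.trace = 1 ∧ ∀ T : Matrix (Fin q) (Fin q) ℂ, T.IsHermitian → T.trace = 1 →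
      lossOf out P p S ≤ lossOf out P p T) ↔ gramSum P S = weightedSum P p := by
  constructor
  · rintro ⟨htr, hmin⟩
    set R := gramSum P S - weightedSum P p with hR
    have hRh : R.IsHermitian :=
      (isHermitian_weightedSum hP _).sub (isHermitian_weightedSum hP p)
    have hRtr : R.trace = 0 := by
      have h1 : (gramSum P S).trace.re = ∑ i, ∑ k, reTraceMul (P i k) S :=
        re_trace_weightedSum hpos _
      rw [← ofReal_re_trace hRh, hR, Matrix.trace_sub, Complex.sub_re, h1,
        re_trace_weightedSum hpos]
      simp [hp, sum_reTraceMul hsum, htr]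
    have hquad : ∀ t : ℝ, 0 ≤ (∑ i, ∑ k, reTraceMul (P i k) R ^ 2 / (P i k).trace.re) * (t * t)
        + 2 * (R * R).trace.re * t + 0 := by
      intro t
      have h := hmin (S + t • R) (hS.add (by simp [Matrix.IsHermitian, hRh.eq]))
        (by simp [hRtr, htr])
      rw [lossOf_add, ← hR] at h
      have h2 : ∑ i, ∑ k, reTraceMul (P i k) (t • R) ^ 2 / (P i k).trace.re
          = (∑ i, ∑ k, reTraceMul (P i k) R ^ 2 / (P i k).trace.re) * (t * t) := by
        simp only [Finset.sum_mul, map_smul, smul_eq_mul]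
        refine Finset.sum_congr rfl fun i _ => Finset.sum_congr rfl fun k _ => ?_
        ring
      rw [h2, Matrix.smul_mul, Matrix.trace_smul, Complex.smul_re, smul_eq_mul] at h
      linarith
    have hd := discrim_le_zero hquad
    rw [discrim] at hd
    refine sub_eq_zero.mp (eq_zero_of_re_trace_mul_self hRh ?_)
    nlinarith [sq_nonneg (R * R).trace.re]
  · intro h
    refine ⟨trace_eq_one_of_gramSum_eq hn hpos hsum hp hS h, fun T _ _ => ?_⟩
    have hT := lossOf_add (P := P) p S (T - S)
    rw [h, sub_self, mul_zero, Matrix.trace_zero, Complex.zero_re, mul_zero, add_zero,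
      add_sub_cancel] at hT
    rw [hT]
    exact le_add_of_nonneg_right <| Finset.sum_nonneg fun i _ => Finset.sum_nonneg fun k _ =>
      div_nonneg (sq_nonneg _) (hpos i k).le

theorem exists_isHermitian_gramSum_eq (hP : ∀ i k, (P i k).IsHermitian)
    (hinj : ∀ Δ : Matrix (Fin q) (Fin q) ℂ, Δ.IsHermitian → gramSum P Δ = 0 → Δ = 0)
    {B : Matrix (Fin q) (Fin q) ℂ} (hB : B.IsHermitian) :
    ∃ S : Matrix (Fin q) (Fin q) ℂ, S.IsHermitian ∧ gramSum P S = B := by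
  let H := selfAdjoint.submodule ℝ (Matrix (Fin q) (Fin q) ℂ)
  have hmap : ∀ S ∈ H, gramSum P S ∈ H := fun S _ => isHermitian_weightedSum hP _
  let L : H →ₗ[ℝ] H := (gramSum P).restrict hmap
  have hL : Function.Injective L := by
    rw [injective_iff_map_eq_zero]
    intro Δ h
    exact Subtype.ext (hinj Δ Δ.2 (congrArg Subtype.val h))
  obtain ⟨S, hS⟩ := LinearMap.injective_iff_surjective.mp hL ⟨B, hB⟩
  exact ⟨S, S.2, congrArg Subtype.val hS⟩

end

/-- For the least-squares loss of a measurement design with data `p`: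
(1) a Hermitian matrix minimizes the loss over trace-one Hermitian matrices iff it satisfies
the normal equation, and every Hermitian solution of the normal equation has trace one;
(2) the set of minimizers is the affine coset `S₀ + N` of the null space
`N = {Δ Hermitian : tr(Δ Π_{ik}) = 0 ∀ i,k}`;
(3) for a complete design the minimizer is unique (and is characterized by the normal
equation, i.e. equals `(nG)⁻¹` applied to `Σ_{i,k} (p_{ik}/m_{ik}) Π_{ik}`). -/
theorem least_squares_normal_equation
    (q n : ℕ) (hq : 2 ≤ q) (hn : 1 ≤ n)
    (out : Fin n → ℕ) (hout : ∀ i, 2 ≤ out i)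
    (P : (i : Fin n) → Fin (out i) → Matrix (Fin q) (Fin q) ℂ)
    (hherm : ∀ i k, (P i k).IsHermitian)
    (hproj : ∀ i k, P i k * P i k = P i k)
    (horth : ∀ i (k k' : Fin (out i)), k ≠ k' → P i k * P i k' = 0)
    (hsum : ∀ i, ∑ k, P i k = 1)
    (hP0 : ∀ i k, P i k ≠ 0)
    (p : (i : Fin n) → Fin (out i) → ℝ) (hp : ∀ i, ∑ k, p i k = 1) :
    (∀ S : Matrix (Fin q) (Fin q) ℂ, S.IsHermitian → normalEq out P p S → S.trace = 1)
    ∧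
    (∀ S : Matrix (Fin q) (Fin q) ℂ, S.IsHermitian →
      ((S.trace = 1 ∧ ∀ T : Matrix (Fin q) (Fin q) ℂ, T.IsHermitian → T.trace = 1 →
          lossOf out P p S ≤ lossOf out P p T)
        ↔ normalEq out P p S))
    ∧
    (∀ S₀ : Matrix (Fin q) (Fin q) ℂ, S₀.IsHermitian → S₀.trace = 1 →
      (∀ T : Matrix (Fin q) (Fin q) ℂ, T.IsHermitian → T.trace = 1 →
          lossOf out P p S₀ ≤ lossOf out P p T) →
      ∀ S : Matrix (Fin q) (Fin q) ℂ, S.IsHermitian →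
        ((S.trace = 1 ∧ ∀ T : Matrix (Fin q) (Fin q) ℂ, T.IsHermitian → T.trace = 1 →
            lossOf out P p S ≤ lossOf out P p T)
          ↔ ∃ Δ : Matrix (Fin q) (Fin q) ℂ, Δ.IsHermitian ∧
              (∀ i k, (Δ * P i k).trace = 0) ∧ S = S₀ + Δ))
    ∧
    ((∀ Δ : Matrix (Fin q) (Fin q) ℂ, Δ.IsHermitian → Δ.trace = 0 →
        (∀ i k, (Δ * P i k).trace = 0) → Δ = 0) →
      ∃! S : Matrix (Fin q) (Fin q) ℂ, S.IsHermitian ∧ S.trace = 1 ∧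
        (∀ T : Matrix (Fin q) (Fin q) ℂ, T.IsHermitian → T.trace = 1 →
          lossOf out P p S ≤ lossOf out P p T) ∧ normalEq out P p S) := by
  have hpos : ∀ i k, 0 < (P i k).trace.re :=
    fun i k => re_trace_pos (hherm i k) (hproj i k) (hP0 i k)
  have hmin {S : Matrix (Fin q) (Fin q) ℂ} (hS : S.IsHermitian) :=
    isMinimizer_iff_gramSum_eq hn hherm hpos hsum hp hS
  refine ⟨fun S hS h => ?_, fun S hS => ?_, fun S₀ hS₀ htr₀ hmin₀ S hS => ?_, fun hcomp => ?_⟩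
  · exact trace_eq_one_of_gramSum_eq hn hpos hsum hp hS ((normalEq_iff_gramSum hherm p hS).mp h)
  · rw [normalEq_iff_gramSum hherm p hS, hmin hS]
  · have h₀ := (hmin hS₀).mp ⟨htr₀, hmin₀⟩
    rw [hmin hS]
    constructor
    · intro h
      refine ⟨S - S₀, hS.sub hS₀, ?_, (add_sub_cancel S₀ S).symm⟩
      rw [← gramSum_eq_zero_iff hherm hpos (hS.sub hS₀), map_sub, h, h₀, sub_self]
    · rintro ⟨Δ, hΔ, h, rfl⟩
      rw [map_add, h₀, (gramSum_eq_zero_iff hherm hpos hΔ).mpr h, add_zero]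
  · have hinj : ∀ Δ : Matrix (Fin q) (Fin q) ℂ, Δ.IsHermitian → gramSum P Δ = 0 → Δ = 0 := by
      intro Δ hΔ h
      have h0 := (gramSum_eq_zero_iff hherm hpos hΔ).mp h
      refine hcomp Δ hΔ ?_ h0
      rw [← mul_one Δ, ← hsum ⟨0, hn⟩, Finset.mul_sum, Matrix.trace_sum]
      exact Finset.sum_eq_zero fun k _ => h0 _ k
    obtain ⟨S, hS, hSeq⟩ :=
      exists_isHermitian_gramSum_eq hherm hinj (isHermitian_weightedSum hherm p)
    have hSmin := (hmin hS).mpr hSeq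
    refine ⟨S, ⟨hS, hSmin.1, hSmin.2, (normalEq_iff_gramSum hherm p hS).mpr hSeq⟩, ?_⟩
    rintro T ⟨hT, -, -, hTeq⟩
    rw [normalEq_iff_gramSum hherm p hT] at hTeq
    refine sub_eq_zero.mp (hinj _ (hT.sub hS) ?_)
    rw [map_sub, hTeq, hSeq, sub_self]
end
end

section
/- Let a = (a_1,…,a_q) ∈ ℝ^q be non-increasing with a_1 + ⋯ + a_q > 0. Define t := max{ 1 ≤ k ≤ q : k a_k + a_{k+1} + ⋯ + a_q ≥ 0 } and v := −(a_{t+1} + ⋯ + a_q)/t. Then 0 ≤ v ≤ a_t, and the constrained optimization problem: minimize Σ_{k=1}^q (a_k − b_k)² subject to b_1 ≥ b_2 ≥ ⋯ ≥ b_q ≥ 0 and b_1 + ⋯ + b_q = a_1 + ⋯ + a_q, has the unique solution b* given by b*_k = a_k − v for k = 1,…,t and b*_k = 0 for k = t+1,…,q. -/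
open Finset

noncomputable section

/-- If the threshold condition fails at every index beyond `t`, then every entry of `a` beyond `t`
lies strictly below the threshold value. -/
theorem succ_mul_lt_neg_tail_sum {q : ℕ} {a : Fin q → ℝ} (ha : Antitone a) {t : Fin q}
    (htmax : ∀ k : Fin q,
      0 ≤ ((k : ℕ) + 1 : ℝ) * a k + ∑ l ∈ Finset.univ.filter (fun l => k < l), a l → k ≤ t)
    {k : Fin q} (hk : t < k) :
    ((t : ℕ) + 1 : ℝ) * a k < -∑ l ∈ Finset.univ.filter (fun l => t < l), a l := by
  have hs : (t : ℕ) + 1 < q := by have := k.isLt; omega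
  let s : Fin q := ⟨t + 1, hs⟩
  have hfilter : Finset.univ.filter (fun l => t < l) =
      insert s (Finset.univ.filter (fun l => s < l)) := by
    ext l
    simp only [Finset.mem_filter, Finset.mem_univ, true_and, Finset.mem_insert, Fin.lt_def,
      Fin.ext_iff, s]
    omega
  have hsum : ∑ l ∈ Finset.univ.filter (fun l => t < l), a l =
      a s + ∑ l ∈ Finset.univ.filter (fun l => s < l), a l := by
    rw [hfilter, Finset.sum_insert (by simp)]
  have hts : t < s := by simp [Fin.lt_def, s]
  have hneg := lt_of_not_ge fun h => (htmax s h).not_gt hts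
  have hcast : ((s : ℕ) : ℝ) = (t : ℕ) + 1 := by simp [s]
  rw [hcast] at hneg
  have hsk : s ≤ k := Fin.le_def.mpr (Nat.succ_le_of_lt hk)
  have hmul : ((t : ℕ) + 1 : ℝ) * a k ≤ ((t : ℕ) + 1 : ℝ) * a s :=
    mul_le_mul_of_nonneg_left (ha hsk) (by positivity)
  rw [hsum]
  linarith

/-- The variational inequality behind projection onto the nonnegative vectors of prescribed sum:
`v` is the multiplier of the sum constraint. -/
theorem sum_sq_sub_add_sum_sq_sub_le {ι : Type*} [Fintype ι] {a b c : ι → ℝ} {v : ℝ}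
    (h : ∀ k, a k - b k = v ∨ a k - b k ≤ v ∧ b k = 0) (hc : ∀ k, 0 ≤ c k)
    (hsum : ∑ k, c k = ∑ k, b k) :
    ∑ k, (a k - b k) ^ 2 + ∑ k, (b k - c k) ^ 2 ≤ ∑ k, (a k - c k) ^ 2 := by
  have hzero : ∑ k, 2 * v * (b k - c k) = 0 := by
    rw [← Finset.mul_sum, Finset.sum_sub_distrib, hsum, sub_self, mul_zero]
  have hle : ∑ k, ((a k - b k) ^ 2 + (b k - c k) ^ 2 + 2 * v * (b k - c k)) ≤
      ∑ k, (a k - c k) ^ 2 := by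
    refine Finset.sum_le_sum fun k _ => ?_
    have hprod : v * (b k - c k) ≤ (a k - b k) * (b k - c k) := by
      rcases h k with hk | ⟨hk, hb⟩
      · rw [hk]
      · exact mul_le_mul_of_nonpos_right hk (by linarith [hc k])
    nlinarith
  rw [Finset.sum_add_distrib, Finset.sum_add_distrib, hzero, add_zero] at hle
  exact hle

/-- **Sum-Preserving Threshold Algorithm.** For a non-increasing sequence
`a : Fin q → ℝ` with positive sum, let `t` be the largest index with
`(t+1)·a_t + Σ_{l>t} a_l ≥ 0` and `v = −(Σ_{l>t} a_l)/(t+1)`. Then `0 ≤ v ≤ a_t`, and the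
vector `b` with `b_k = a_k − v` for `k ≤ t` and `b_k = 0` otherwise is the unique solution of:
minimize `Σ (a_k − c_k)²` over non-increasing nonnegative `c` with `Σ c_k = Σ a_k`.
(Indices of `Fin q` are 0-based, so the 1-based index `k` of the paper corresponds to
`(k : ℕ) + 1` here.) -/
theorem sum_preserving_threshold_algorithm
    (q : ℕ) (hq : 1 ≤ q)
    (a : Fin q → ℝ) (ha : Antitone a) (hsum : 0 < ∑ k, a k)
    (t : Fin q)
    (ht : 0 ≤ ((t : ℕ) + 1 : ℝ) * a t + ∑ l ∈ Finset.univ.filter (fun l => t < l), a l)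
    (htmax : ∀ k : Fin q,
      0 ≤ ((k : ℕ) + 1 : ℝ) * a k + ∑ l ∈ Finset.univ.filter (fun l => k < l), a l → k ≤ t)
    (v : ℝ)
    (hv : v = -(∑ l ∈ Finset.univ.filter (fun l => t < l), a l) / ((t : ℕ) + 1 : ℝ))
    (b : Fin q → ℝ)
    (hb : ∀ k, b k = if k ≤ t then a k - v else 0) :
    (0 ≤ v ∧ v ≤ a t)
    ∧
    (Antitone b ∧ (∀ k, 0 ≤ b k) ∧ ∑ k, b k = ∑ k, a k)
    ∧
    (∀ c : Fin q → ℝ, Antitone c → (∀ k, 0 ≤ c k) → ∑ k, c k = ∑ k, a k →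
      ∑ k, (a k - b k) ^ 2 ≤ ∑ k, (a k - c k) ^ 2)
    ∧
    (∀ c : Fin q → ℝ, Antitone c → (∀ k, 0 ≤ c k) → ∑ k, c k = ∑ k, a k →
      ∑ k, (a k - c k) ^ 2 = ∑ k, (a k - b k) ^ 2 → c = b) := by
  have hpos : (0 : ℝ) < (t : ℕ) + 1 := by positivity
  have hv_mul : ((t : ℕ) + 1 : ℝ) * v = -∑ l ∈ Finset.univ.filter (fun l => t < l), a l := by
    rw [hv, mul_div_cancel₀ _ hpos.ne']
  have htail : ∀ k, t < k → a k < v := fun k hk =>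
    lt_of_mul_lt_mul_left (hv_mul ▸ succ_mul_lt_neg_tail_sum ha htmax hk) hpos.le
  have hv_nonneg : 0 ≤ v := by
    by_contra! hneg
    have hnonpos : ∑ l ∈ Finset.univ.filter (fun l => t < l), a l ≤ 0 :=
      Finset.sum_nonpos fun l hl => ((htail l (Finset.mem_filter.mp hl).2).trans hneg).le
    nlinarith
  have hv_le : v ≤ a t := le_of_mul_le_mul_left (by linarith) hpos
  have hb_nonneg : ∀ k, 0 ≤ b k := by
    intro k
    rw [hb]
    split_ifs with hk
    · linarith [ha hk]
    · exact le_rfl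
  have hb_antitone : Antitone b := by
    intro i j hij
    by_cases hj : j ≤ t
    · rw [hb, hb, if_pos hj, if_pos (hij.trans hj)]
      linarith [ha hij]
    · rw [hb j, if_neg hj]
      exact hb_nonneg i
  have hb_sum : ∑ k, b k = ∑ k, a k := by
    have hsplit := Finset.sum_filter_add_sum_filter_not Finset.univ (fun k => k ≤ t) a
    have hcard : (Finset.univ.filter (fun k => k ≤ t)).card = (t : ℕ) + 1 := by
      rw [Finset.filter_ge_eq_Iic, Fin.card_Iic]
    simp only [not_le] at hsplit
    simp only [hb]
    rw [← Finset.sum_filter, Finset.sum_sub_distrib, Finset.sum_const, hcard, nsmul_eq_mul]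
    push_cast
    linarith
  have hmultiplier : ∀ k, a k - b k = v ∨ a k - b k ≤ v ∧ b k = 0 := by
    intro k
    by_cases hk : k ≤ t
    · left
      rw [hb, if_pos hk, sub_sub_cancel]
    · right
      rw [hb, if_neg hk, sub_zero]
      exact ⟨(htail k (not_le.mp hk)).le, rfl⟩
  refine ⟨⟨hv_nonneg, hv_le⟩, ⟨hb_antitone, hb_nonneg, hb_sum⟩, ?_, ?_⟩
  · intro c _ hc hc_sum
    have hle := sum_sq_sub_add_sum_sq_sub_le hmultiplier hc (hc_sum.trans hb_sum.symm)
    have hnonneg : 0 ≤ ∑ k, (b k - c k) ^ 2 := Finset.sum_nonneg fun k _ => sq_nonneg _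
    linarith
  · intro c _ hc hc_sum heq
    have hle := sum_sq_sub_add_sum_sq_sub_le hmultiplier hc (hc_sum.trans hb_sum.symm)
    have hnonneg : ∀ k ∈ Finset.univ, 0 ≤ (b k - c k) ^ 2 := fun k _ => sq_nonneg _
    have hzero : ∑ k, (b k - c k) ^ 2 = 0 :=
      le_antisymm (by linarith) (Finset.sum_nonneg hnonneg)
    funext k
    have hk := (Finset.sum_eq_zero_iff_of_nonneg hnonneg).mp hzero k (Finset.mem_univ k)
    exact (sub_eq_zero.mp (pow_eq_zero_iff two_ne_zero |>.mp hk)).symm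
end
end

section
/- Let S ∈ ℂ^{q×q} be Hermitian with tr(S) > 0, and let S = U Diag(a) U* be a spectral decomposition with U unitary and a = (a_1,…,a_q) the vector of (real) eigenvalues sorted in non-increasing order. Let b* ∈ ℝ^q be defined by b*_k = a_k − v for k ≤ t and b*_k = 0 for k > t, where t = max{k : k a_k + a_{k+1} + ⋯ + a_q ≥ 0} and v = −(a_{t+1} + ⋯ + a_q)/t. Then the optimization problem: minimize ‖S − T‖₂² over Hermitian positive semidefinite T ∈ ℂ^{q×q} with tr(T) = tr(S), has the unique solution T* = U Diag(b*) U*. -/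
open Matrix Finset
open scoped ComplexOrder

noncomputable section

/-- The squared Frobenius (Hilbert–Schmidt) norm of a complex matrix. -/
def frobSq {q : ℕ} (M : Matrix (Fin q) (Fin q) ℂ) : ℝ :=
  ∑ a, ∑ b, Complex.normSq (M a b)

theorem frobSq_eq_trace {q : ℕ} (M : Matrix (Fin q) (Fin q) ℂ) :
    (frobSq M : ℂ) = (Mᴴ * M).trace := by
  simp only [frobSq, Matrix.trace, Matrix.diag_apply, Matrix.mul_apply,
    Matrix.conjTranspose_apply, Complex.ofReal_sum, Complex.normSq_eq_conj_mul_self]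
  exact Finset.sum_comm

theorem frobSq_unitary_conj {q : ℕ} {U : Matrix (Fin q) (Fin q) ℂ} (hU : Uᴴ * U = 1)
    (M : Matrix (Fin q) (Fin q) ℂ) : frobSq (U * M * Uᴴ) = frobSq M := by
  apply Complex.ofReal_injective
  rw [frobSq_eq_trace, frobSq_eq_trace]
  have h : (U * M * Uᴴ)ᴴ * (U * M * Uᴴ) = U * (Mᴴ * M) * Uᴴ := by
    simp only [Matrix.conjTranspose_mul, Matrix.conjTranspose_conjTranspose, Matrix.mul_assoc]
    rw [← Matrix.mul_assoc Uᴴ U, hU, Matrix.one_mul]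
  rw [h, Matrix.trace_mul_comm, ← Matrix.mul_assoc, hU, Matrix.one_mul]

theorem frobSq_nonneg {q : ℕ} (M : Matrix (Fin q) (Fin q) ℂ) : 0 ≤ frobSq M :=
  Finset.sum_nonneg fun _ _ => Finset.sum_nonneg fun _ _ => Complex.normSq_nonneg _

theorem eq_zero_of_frobSq_eq_zero {q : ℕ} {M : Matrix (Fin q) (Fin q) ℂ} (h : frobSq M = 0) :
    M = 0 := by
  ext i j
  have h₁ := (Finset.sum_eq_zero_iff_of_nonneg fun i _ =>
    Finset.sum_nonneg fun j _ => Complex.normSq_nonneg (M i j)).1 h i (Finset.mem_univ i)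
  have h₂ := (Finset.sum_eq_zero_iff_of_nonneg fun j _ =>
    Complex.normSq_nonneg (M i j)).1 h₁ j (Finset.mem_univ j)
  exact Complex.normSq_eq_zero.1 h₂

/-- Expansion of the squared distance from a real diagonal matrix around another one. -/
theorem frobSq_diagonal_sub {q : ℕ} (a b : Fin q → ℝ) (W : Matrix (Fin q) (Fin q) ℂ) :
    frobSq (Matrix.diagonal (fun k => (a k : ℂ)) - W) =
      frobSq (Matrix.diagonal (fun k => (a k : ℂ)) - Matrix.diagonal (fun k => (b k : ℂ))) +
      frobSq (Matrix.diagonal (fun k => (b k : ℂ)) - W) +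
      2 * ∑ k, (a k - b k) * (b k - (W k k).re) := by
  simp only [frobSq, Finset.mul_sum, ← Finset.sum_add_distrib]
  refine Finset.sum_congr rfl fun i _ => ?_
  have h : 2 * ((a i - b i) * (b i - (W i i).re)) =
      ∑ j, if i = j then 2 * ((a i - b i) * (b i - (W i i).re)) else 0 := by simp
  rw [h, ← Finset.sum_add_distrib]
  refine Finset.sum_congr rfl fun j _ => ?_
  by_cases hij : i = j
  · subst hij
    simp [Complex.normSq_apply]
    ring
  · simp [hij]

/-- The entries discarded by the threshold algorithm lie strictly below the threshold. -/
theorem lt_threshold_of_lt {q : ℕ} {a : Fin q → ℝ} (ha : Antitone a) {t : Fin q}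
    (htmax : ∀ k : Fin q,
      0 ≤ ((k : ℕ) + 1 : ℝ) * a k + ∑ l ∈ Finset.univ.filter (fun l => k < l), a l → k ≤ t)
    {k : Fin q} (hk : t < k) :
    a k < -(∑ l ∈ Finset.univ.filter (fun l => t < l), a l) / ((t : ℕ) + 1 : ℝ) := by
  have hk' : (t : ℕ) < k := hk
  let s : Fin q := ⟨t + 1, by omega⟩
  have hts : t < s := Fin.lt_def.2 (Nat.lt_succ_self _)
  have hsk : s ≤ k := Fin.le_def.2 hk'
  have hneg := not_le.1 (mt (htmax s) (not_le.2 hts))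
  have hset : Finset.univ.filter (fun l => t < l) =
      insert s (Finset.univ.filter (fun l => s < l)) := by
    ext l
    simp only [Finset.mem_filter, Finset.mem_univ, true_and, Finset.mem_insert, Fin.lt_def,
      Fin.ext_iff, s]
    omega
  have hs : ((s : ℕ) : ℝ) = (t : ℕ) + 1 := by simp [s]
  refine (ha hsk).trans_lt ?_
  rw [lt_div_iff₀ (by positivity), hset, Finset.sum_insert (by simp)]
  rw [hs] at hneg
  linarith

/-- The threshold algorithm preserves the sum. -/
theorem sum_threshold {q : ℕ} (a : Fin q → ℝ) (t : Fin q) {v : ℝ}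
    (hv : v = -(∑ l ∈ Finset.univ.filter (fun l => t < l), a l) / ((t : ℕ) + 1 : ℝ)) :
    (∑ k, if k ≤ t then a k - v else 0) = ∑ k, a k := by
  have hpos : (0 : ℝ) < (t : ℕ) + 1 := by positivity
  rw [eq_div_iff hpos.ne'] at hv
  have hcard : (Finset.univ.filter (fun k => k ≤ t)).card = (t : ℕ) + 1 := by
    rw [← Fin.card_Iic t]
    congr 1
    ext k
    simp
  have hsplit := Finset.sum_filter_add_sum_filter_not Finset.univ (fun k => k ≤ t) a
  simp only [not_le] at hsplit
  rw [← Finset.sum_filter, Finset.sum_sub_distrib, Finset.sum_const, hcard, nsmul_eq_mul]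
  push_cast
  linarith

/-- The obtuse-angle inequality characterizing the threshold vector as a projection. -/
theorem threshold_inner_nonneg {q : ℕ} {a b w : Fin q → ℝ} {t : Fin q} {v : ℝ}
    (hb : ∀ k, b k = if k ≤ t then a k - v else 0) (hav : ∀ k, t < k → a k < v)
    (hw : ∀ k, 0 ≤ w k) (hsum : ∑ k, w k = ∑ k, b k) :
    0 ≤ ∑ k, (a k - b k) * (b k - w k) := by
  have h : ∑ k, (a k - b k) * (b k - w k) = ∑ k, (a k - b k - v) * (b k - w k) := by
    simp only [sub_mul (_ - _) v, Finset.sum_sub_distrib (f := fun k => (a k - b k) * (b k - w k)),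
      ← Finset.mul_sum, Finset.sum_sub_distrib (f := b), hsum]
    ring
  rw [h]
  refine Finset.sum_nonneg fun k _ => ?_
  rw [hb k]
  split_ifs with hk
  · simp
  · have := mul_nonneg (sub_nonneg.2 (hav k (not_le.1 hk)).le) (hw k)
    linarith

/-- **trace-preserving projection.** Let `S` be Hermitian with positive trace
and spectral decomposition `S = U Diag(a) U*` with eigenvalues `a` sorted non-increasingly.
With `b` the output of the sum-preserving threshold algorithm applied to `a`, the matrix
`T = U Diag(b) U*` is the unique minimizer of `‖S − T‖₂²` over Hermitian positive
semidefinite matrices with `tr(T) = tr(S)`. -/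
theorem trace_preserving_projection
    (q : ℕ)
    (S U : Matrix (Fin q) (Fin q) ℂ)
    (hS : S.IsHermitian) (hStr : 0 < S.trace.re)
    (hU : U ∈ Matrix.unitaryGroup (Fin q) ℂ)
    (a : Fin q → ℝ) (ha : Antitone a)
    (hdecomp : S = U * Matrix.diagonal (fun k => (a k : ℂ)) * Uᴴ)
    (t : Fin q)
    (ht : 0 ≤ ((t : ℕ) + 1 : ℝ) * a t + ∑ l ∈ Finset.univ.filter (fun l => t < l), a l)
    (htmax : ∀ k : Fin q,
      0 ≤ ((k : ℕ) + 1 : ℝ) * a k + ∑ l ∈ Finset.univ.filter (fun l => k < l), a l → k ≤ t)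
    (v : ℝ)
    (hv : v = -(∑ l ∈ Finset.univ.filter (fun l => t < l), a l) / ((t : ℕ) + 1 : ℝ))
    (b : Fin q → ℝ)
    (hb : ∀ k, b k = if k ≤ t then a k - v else 0)
    (T : Matrix (Fin q) (Fin q) ℂ)
    (hT : T = U * Matrix.diagonal (fun k => (b k : ℂ)) * Uᴴ) :
    T.PosSemidef ∧ T.trace = S.trace ∧
    (∀ T' : Matrix (Fin q) (Fin q) ℂ, T'.PosSemidef → T'.trace = S.trace →
      frobSq (S - T) ≤ frobSq (S - T'))
    ∧
    (∀ T' : Matrix (Fin q) (Fin q) ℂ, T'.PosSemidef → T'.trace = S.trace →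
      frobSq (S - T') = frobSq (S - T) → T' = T) := by
  have hUU : Uᴴ * U = 1 := Matrix.mem_unitaryGroup_iff'.1 hU
  have hUU' : U * Uᴴ = 1 := Matrix.mem_unitaryGroup_iff.1 hU
  have htrace (M : Matrix (Fin q) (Fin q) ℂ) : (U * M * Uᴴ).trace = M.trace := by
    rw [Matrix.trace_mul_comm, ← Matrix.mul_assoc, hUU, Matrix.one_mul]
  have hav (k) (hk : t < k) : a k < v := hv ▸ lt_threshold_of_lt ha htmax hk
  have hvt : v ≤ a t := by
    rw [hv, div_le_iff₀ (by positivity)]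
    linarith
  have hb0 (k) : 0 ≤ b k := by
    rw [hb k]
    split_ifs with hk
    · linarith [ha hk]
    · exact le_rfl
  have hsum : ∑ k, b k = ∑ k, a k := by
    simp only [hb]
    exact sum_threshold a t hv
  have hST : S - T = U * (Matrix.diagonal (fun k => (a k : ℂ)) -
      Matrix.diagonal (fun k => (b k : ℂ))) * Uᴴ := by
    rw [hdecomp, hT, Matrix.mul_sub, Matrix.sub_mul]
  have key (T' : Matrix (Fin q) (Fin q) ℂ) (hT' : T'.PosSemidef) (htr : T'.trace = S.trace) :
      frobSq (S - T) + frobSq (T - T') ≤ frobSq (S - T') := by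
    obtain ⟨W, hW, hWT⟩ : ∃ W : Matrix (Fin q) (Fin q) ℂ, W.PosSemidef ∧ T' = U * W * Uᴴ := by
      refine ⟨Uᴴ * T' * U, hT'.conjTranspose_mul_mul_same U, ?_⟩
      rw [← Matrix.mul_assoc, ← Matrix.mul_assoc, hUU', Matrix.one_mul, Matrix.mul_assoc, hUU',
        Matrix.mul_one]
    have hTT : T - T' = U * (Matrix.diagonal (fun k => (b k : ℂ)) - W) * Uᴴ := by
      rw [hT, hWT, Matrix.mul_sub, Matrix.sub_mul]
    have hST' : S - T' = U * (Matrix.diagonal (fun k => (a k : ℂ)) - W) * Uᴴ := by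
      rw [hdecomp, hWT, Matrix.mul_sub, Matrix.sub_mul]
    rw [hST, hTT, hST', frobSq_unitary_conj hUU, frobSq_unitary_conj hUU,
      frobSq_unitary_conj hUU, frobSq_diagonal_sub a b W]
    have hWsum : ∑ k, (W k k).re = ∑ k, b k := by
      rw [hWT, hdecomp, htrace, htrace] at htr
      have := congrArg Complex.re htr
      simpa [Matrix.trace, hsum] using this
    have := threshold_inner_nonneg (w := fun k => (W k k).re) hb hav
      (fun k => (Complex.nonneg_iff.1 hW.diag_nonneg).1) hWsum
    linarith
  refine ⟨?_, ?_, fun T' hT' htr => ?_, fun T' hT' htr heq => ?_⟩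
  · rw [hT]
    exact (Matrix.PosSemidef.diagonal fun k =>
      Complex.zero_le_real.2 (hb0 k)).mul_mul_conjTranspose_same U
  · rw [hT, hdecomp, htrace, htrace, Matrix.trace_diagonal, Matrix.trace_diagonal]
    exact_mod_cast hsum
  · linarith [key T' hT' htr, frobSq_nonneg (T - T')]
  · have h := key T' hT' htr
    have h0 : frobSq (T - T') = 0 := le_antisymm (by linarith) (frobSq_nonneg _)
    exact (sub_eq_zero.1 (eq_zero_of_frobSq_eq_zero h0)).symm
end
end

section
/- Let q ≥ 2, let φ, ψ ∈ ℂ^q be unit vectors with ⟨φ, ψ⟩ = 0, and let S ∈ ℂ^{q×q} be Hermitian with tr(S) = 0. Let U be a random unitary matrix distributed according to the Haar probability measure on the unitary group U(q). Then E[ ⟨S(U*φ), U*φ⟩ · (U*φ)(U*φ)* ] = S/(q(q+1)) and E[ ⟨S(U*φ), U*φ⟩ · (U*ψ)(U*ψ)* ] = −S/(q(q+1)(q−1)), where the expectations are entrywise (Bochner) integrals of matrix-valued functions over U(q). -/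
open Matrix Finset MeasureTheory

noncomputable section

instance matrixMeasurableSpace (q : ℕ) : MeasurableSpace (Matrix (Fin q) (Fin q) ℂ) :=
  inferInstanceAs (MeasurableSpace (Fin q → Fin q → ℂ))

instance matrixBorelSpace (q : ℕ) : BorelSpace (Matrix (Fin q) (Fin q) ℂ) :=
  inferInstanceAs (BorelSpace (Fin q → Fin q → ℂ))

instance matrixSecondCountableTopology (q : ℕ) :
    SecondCountableTopology (Matrix (Fin q) (Fin q) ℂ) :=
  inferInstanceAs (SecondCountableTopology (Fin q → Fin q → ℂ))

instance matrixPseudoMetrizableSpace (q : ℕ) :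
    TopologicalSpace.PseudoMetrizableSpace (Matrix (Fin q) (Fin q) ℂ) :=
  inferInstanceAs (TopologicalSpace.PseudoMetrizableSpace (Fin q → Fin q → ℂ))

theorem isCompact_unitaryGroup (q : ℕ) :
    IsCompact (Matrix.unitaryGroup (Fin q) ℂ : Set (Matrix (Fin q) (Fin q) ℂ)) := by
  have hK : IsCompact (Set.univ.pi fun _ => Set.univ.pi fun _ => Metric.closedBall 0 1 :
      Set (Fin q → Fin q → ℂ)) :=
    isCompact_univ_pi fun _ => isCompact_univ_pi fun _ => isCompact_closedBall 0 1
  refine IsCompact.of_isClosed_subset (X := Matrix (Fin q) (Fin q) ℂ) hK isClosed_unitary ?_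
  intro U hU i _ j _
  simpa using entry_norm_bound_of_unitary hU i j

theorem integrable_of_ae_mem_compact {X : Type*} [TopologicalSpace X] [MeasurableSpace X]
    [BorelSpace X] [SecondCountableTopology X] [T2Space X]
    [TopologicalSpace.PseudoMetrizableSpace X] {μ : Measure X} [IsFiniteMeasure μ] {K : Set X}
    (hK : IsCompact K) (hμ : ∀ᵐ x ∂μ, x ∈ K) {f : X → ℂ} (hf : Continuous f) : Integrable f μ := by
  have := hf.continuousOn.integrableOn_compact (μ := μ) hK
  rwa [IntegrableOn, Measure.restrict_eq_self_of_ae_mem hμ] at this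

theorem exists_unitary_two_columns {q : ℕ} {i j : Fin q} (hij : i ≠ j) (x y : Fin q → ℂ)
    (hx : ∑ a, Complex.normSq (x a) = 1) (hy : ∑ a, Complex.normSq (y a) = 1)
    (hxy : ∑ a, x a * (starRingEnd ℂ) (y a) = 0) :
    ∃ W ∈ Matrix.unitaryGroup (Fin q) ℂ, (∀ c, W c i = x c) ∧ ∀ c, W c j = y c := by
  have hn : ∀ z : Fin q → ℂ, ∑ a, Complex.normSq (z a) = 1 → ‖WithLp.toLp 2 z‖ = 1 := by
    intro z hz
    simp only [Complex.normSq_eq_norm_sq] at hz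
    simp [EuclideanSpace.norm_eq, hz]
  let v : Fin q → EuclideanSpace ℂ (Fin q) :=
    fun k => if k = i then WithLp.toLp 2 x else WithLp.toLp 2 y
  have hyx : inner ℂ (WithLp.toLp 2 y) (WithLp.toLp 2 x) = (0 : ℂ) := by
    simpa [PiLp.inner_apply] using hxy
  have hv : Orthonormal ℂ (({i, j} : Set (Fin q)).domRestrict v) := by
    constructor
    · rintro ⟨k, hk⟩
      rcases hk with rfl | rfl
      · simpa [v] using hn x hx
      · simpa [v, hij.symm] using hn y hy
    · rintro ⟨k, hk⟩ ⟨l, hl⟩ hkl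
      rcases hk with rfl | rfl <;> rcases hl with rfl | rfl
      · simp at hkl
      · simpa [v, hij.symm] using inner_eq_zero_symm.1 hyx
      · simpa [v, hij.symm] using hyx
      · simp at hkl
  obtain ⟨b, hb⟩ := hv.exists_orthonormalBasis_extension_of_card_eq (by simp)
  refine ⟨Matrix.of fun c k => b k c, ?_, fun c => ?_, fun c => ?_⟩
  · rw [mem_unitaryGroup_iff']
    ext k l
    have := b.inner_eq_ite k l
    rw [PiLp.inner_apply] at this
    simpa [Matrix.mul_apply, Matrix.one_apply, star_apply, mul_comm] using this
  · simp [hb i (by simp), v]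
  · simp [hb j (by simp), v, hij.symm]

section HaarMoments

variable {q : ℕ} {μ : Measure (Matrix (Fin q) (Fin q) ℂ)} [IsProbabilityMeasure μ]
  (hsupp : ∀ᵐ U ∂μ, U ∈ Matrix.unitaryGroup (Fin q) ℂ)
  (hinv : ∀ V ∈ Matrix.unitaryGroup (Fin q) ℂ, Measure.map (fun U => V * U) μ = μ)

omit [IsProbabilityMeasure μ] in
include hinv in
theorem integral_mul_left_unitary {f : Matrix (Fin q) (Fin q) ℂ → ℂ} (hf : Continuous f)
    {V : Matrix (Fin q) (Fin q) ℂ} (hV : V ∈ Matrix.unitaryGroup (Fin q) ℂ) :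
    ∫ U, f (V * U) ∂μ = ∫ U, f U ∂μ := by
  have hc : Continuous fun U : Matrix (Fin q) (Fin q) ℂ => V * U := by fun_prop
  conv_rhs => rw [← hinv V hV]
  rw [integral_map hc.measurable.aemeasurable hf.aestronglyMeasurable]

include hsupp hinv in
theorem integral_conjTranspose_unitary {f : Matrix (Fin q) (Fin q) ℂ → ℂ} (hf : Continuous f) :
    ∫ U, f Uᴴ ∂μ = ∫ U, f U ∂μ := by
  have hstar : ∀ {U : Matrix (Fin q) (Fin q) ℂ}, U ∈ Matrix.unitaryGroup (Fin q) ℂ →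
      Uᴴ ∈ Matrix.unitaryGroup (Fin q) ℂ := fun h => Unitary.star_mem h
  have hint : Integrable (Function.uncurry fun U V : Matrix (Fin q) (Fin q) ℂ => f (Vᴴ * U))
      (μ.prod μ) := by
    refine integrable_of_ae_mem_compact ((isCompact_unitaryGroup q).prod (isCompact_unitaryGroup q))
      ?_ (by unfold Function.uncurry; fun_prop)
    filter_upwards [Measure.quasiMeasurePreserving_fst.ae hsupp,
      Measure.quasiMeasurePreserving_snd.ae hsupp] with x hx hy using ⟨hx, hy⟩
  have h₁ : ∫ V, ∫ U, f (Vᴴ * U) ∂μ ∂μ = ∫ U, f U ∂μ := by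
    rw [integral_congr_ae (g := fun _ => ∫ U, f U ∂μ)]
    · simp
    · filter_upwards [hsupp] with V hV
      exact integral_mul_left_unitary hinv hf (hstar hV)
  have h₂ : ∫ U, ∫ V, f (Vᴴ * U) ∂μ ∂μ = ∫ U, f Uᴴ ∂μ := by
    rw [integral_congr_ae (g := fun _ => ∫ U, f Uᴴ ∂μ)]
    · simp
    · filter_upwards [hsupp] with U hU
      have := integral_mul_left_unitary hinv (f := fun V => f Vᴴ) (by fun_prop) (hstar hU)
      simpa [conjTranspose_mul] using this
  rw [← h₁, ← h₂, integral_integral_swap hint]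

include hsupp hinv in
theorem integral_mul_right_unitary {f : Matrix (Fin q) (Fin q) ℂ → ℂ} (hf : Continuous f)
    {W : Matrix (Fin q) (Fin q) ℂ} (hW : W ∈ Matrix.unitaryGroup (Fin q) ℂ) :
    ∫ U, f (U * W) ∂μ = ∫ U, f U ∂μ := by
  rw [← integral_conjTranspose_unitary hsupp hinv (f := fun U => f (U * W)) (by fun_prop),
    ← integral_conjTranspose_unitary hsupp hinv hf,
    ← integral_mul_left_unitary hinv (f := fun U => f Uᴴ) (by fun_prop)
      (show Wᴴ ∈ Matrix.unitaryGroup (Fin q) ℂ from Unitary.star_mem hW)]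
  simp [conjTranspose_mul]


/-- The fourth moment of entries of the `i`-th row. -/
def rowMoment (μ : Measure (Matrix (Fin q) (Fin q) ℂ)) (i a b c d : Fin q) : ℂ :=
  ∫ U, (starRingEnd ℂ) (U i a) * U i b * ((starRingEnd ℂ) (U i c) * U i d) ∂μ

include hsupp hinv in
theorem rowMoment_phase (i k a b c d : Fin q) :
    rowMoment μ i a b c d =
      (starRingEnd ℂ) (if a = k then Complex.I else 1) * (if b = k then Complex.I else 1) *
        ((starRingEnd ℂ) (if c = k then Complex.I else 1) * (if d = k then Complex.I else 1)) *
        rowMoment μ i a b c d := by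
  let z : Fin q → ℂ := fun a => if a = k then Complex.I else 1
  have hW : diagonal z ∈ Matrix.unitaryGroup (Fin q) ℂ := by
    rw [mem_unitaryGroup_iff, star_eq_conjTranspose, diagonal_conjTranspose, diagonal_mul_diagonal,
      ← diagonal_one]
    congr 1
    ext a
    by_cases h : a = k <;> simp [z, h]
  have h := integral_mul_right_unitary hsupp hinv (f := fun U =>
    (starRingEnd ℂ) (U i a) * U i b * ((starRingEnd ℂ) (U i c) * U i d))
    (by fun_prop) hW
  rw [rowMoment, ← integral_const_mul]
  conv_lhs => rw [← h]
  refine integral_congr_ae (ae_of_all _ fun U => ?_)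
  simp only [mul_diagonal, map_mul, z]
  ring

include hsupp hinv in
theorem rowMoment_eq_zero {i a b c d : Fin q} (h₁ : ¬(a = b ∧ c = d)) (h₂ : ¬(a = d ∧ b = c)) :
    rowMoment μ i a b c d = 0 := by
  have key : ∀ z : ℂ, z ≠ 1 → rowMoment μ i a b c d = z * rowMoment μ i a b c d →
      rowMoment μ i a b c d = 0 := by
    intro z hz h
    have : (z - 1) * rowMoment μ i a b c d = 0 := by rw [sub_mul, ← h]; ring
    exact (mul_eq_zero.1 this).resolve_left (sub_ne_zero.2 hz)
  by_cases hac : a = c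
  · subst hac
    by_cases hab : a = b
    · subst hab
      refine key _ ?_ (rowMoment_phase hsupp hinv i a a a a d)
      have : d ≠ a := fun h => h₁ ⟨rfl, h.symm⟩
      simp [this, Complex.ext_iff]
    · refine key _ ?_ (rowMoment_phase hsupp hinv i a a b a d)
      by_cases hd : d = a <;> simp [Ne.symm hab, hd, Complex.ext_iff]
      norm_num
  · by_cases hab : a = b
    · subst hab
      refine key _ ?_ (rowMoment_phase hsupp hinv i c a a c d)
      have : d ≠ c := fun h => h₁ ⟨rfl, h.symm⟩
      simp [hac, this, Complex.ext_iff]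
    · by_cases had : a = d
      · subst had
        refine key _ ?_ (rowMoment_phase hsupp hinv i c a b c a)
        have : b ≠ c := fun h => h₂ ⟨rfl, h⟩
        simp [hac, this, Complex.ext_iff]
      · refine key _ ?_ (rowMoment_phase hsupp hinv i a a b c d)
        simp [Ne.symm hac, Ne.symm hab, Ne.symm had, Complex.ext_iff]

omit [IsProbabilityMeasure μ] in
theorem rowMoment_swap_right (i a b c d : Fin q) :
    rowMoment μ i a b c d = rowMoment μ i a d c b := by
  unfold rowMoment
  congr 1
  ext U
  ring

omit [IsProbabilityMeasure μ] in
theorem rowMoment_swap_left (i a b c d : Fin q) :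
    rowMoment μ i a b c d = rowMoment μ i c b a d := by
  unfold rowMoment
  congr 1
  ext U
  ring

include hsupp in
theorem integrable_of_ae_unitary {f : Matrix (Fin q) (Fin q) ℂ → ℂ} (hf : Continuous f) :
    Integrable f μ :=
  integrable_of_ae_mem_compact (isCompact_unitaryGroup q) hsupp hf

include hsupp hinv in
theorem rowMoment_rotate {i a b : Fin q} (hab : a ≠ b) {k : Fin q} {s : ℂ}
    {W : Matrix (Fin q) (Fin q) ℂ} (hW : W ∈ Matrix.unitaryGroup (Fin q) ℂ)
    (hs : s ^ 2 = 1 / 2) (hs' : (starRingEnd ℂ) s = s) {t : ℂ} (ht : t ^ 2 = 1)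
    (ht' : (starRingEnd ℂ) t = t)
    (hWk : ∀ c, W c k = (if c = a then s else 0) + (if c = b then t * s else 0)) :
    4 * rowMoment μ i k k k k = rowMoment μ i a a a a + rowMoment μ i b b b b +
      4 * rowMoment μ i a a b b := by
  have h := integral_mul_right_unitary hsupp hinv (f := fun U =>
    (starRingEnd ℂ) (U i k) * U i k * ((starRingEnd ℂ) (U i k) * U i k)) (by fun_prop) hW
  have hUW : ∀ U : Matrix (Fin q) (Fin q) ℂ, (U * W) i k = s * (U i a + t * U i b) := by
    intro U
    simp only [Matrix.mul_apply, hWk, mul_add, Finset.sum_add_distrib]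
    simp
    ring
  have hz := @rowMoment_eq_zero q μ _ hsupp hinv i
  rw [rowMoment, ← h]
  let m : Fin q → Fin q → Fin q → Fin q → Matrix (Fin q) (Fin q) ℂ → ℂ := fun a b c d U =>
    (starRingEnd ℂ) (U i a) * U i b * ((starRingEnd ℂ) (U i c) * U i d)
  have hm : ∀ a b c d, Integrable (m a b c d) μ := fun a b c d =>
    integrable_of_ae_unitary hsupp (by fun_prop)
  have hexp : (fun U : Matrix (Fin q) (Fin q) ℂ => (starRingEnd ℂ) ((U * W) i k) * (U * W) i k *
      ((starRingEnd ℂ) ((U * W) i k) * (U * W) i k)) = fun U => (1 / 4 : ℂ) * (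
        m a a a a U + m b b b b U + m a a b b U + m a b b a U + m b a a b U + m b b a a U
        + m a b a b U + m b a b a U
        + t * m b a a a U + t * m a b a a U + t * m a a b a U + t * m a a a b U
        + t * m a b b b U + t * m b a b b U + t * m b b a b U + t * m b b b a U) := by
    ext U
    simp only [hUW, map_mul, map_add, hs', ht', m]
    have hs4 : s ^ 4 = 1 / 4 := by rw [show s ^ 4 = (s ^ 2) ^ 2 by ring, hs]; norm_num
    have ht3 : t ^ 3 = t := by rw [pow_succ, ht, one_mul]
    have ht4 : t ^ 4 = 1 := by rw [show t ^ 4 = (t ^ 2) ^ 2 by ring, ht]; norm_num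
    ring_nf
    simp only [hs4, ht3, ht4, ht]
    ring
  have hM : ∀ a b c d, ∫ U, m a b c d U ∂μ = rowMoment μ i a b c d := fun _ _ _ _ => rfl
  rw [hexp, integral_const_mul]
  iterate 15 rw [integral_add (by fun_prop) (by fun_prop)]
  simp only [integral_const_mul, hM]
  rw [rowMoment_swap_right i a b b a, rowMoment_swap_left i b a a b,
    rowMoment_swap_left i b b a a, rowMoment_swap_right i a b b a]
  have hba := hab.symm
  rw [@hz a b a b, @hz b a b a, @hz b a a a, @hz a b a a, @hz a a b a, @hz a a a b, @hz a b b b,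
    @hz b a b b, @hz b b a b, @hz b b b a]
  · ring
  all_goals simp [hab, hba]


include hsupp hinv in
theorem rowMoment_diagonal {i a b : Fin q} (hab : a ≠ b) :
    rowMoment μ i b b b b = rowMoment μ i a a a a ∧
      rowMoment μ i a a b b = rowMoment μ i a a a a / 2 := by
  let s : ℂ := ((Real.sqrt (1 / 2) : ℝ) : ℂ)
  have hs : s ^ 2 = 1 / 2 := by
    simp only [s, ← Complex.ofReal_pow, Real.sq_sqrt (show (0 : ℝ) ≤ 1 / 2 by norm_num)]
    norm_num
  have hs' : (starRingEnd ℂ) s = s := Complex.conj_ofReal _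
  have hn : Complex.normSq s = 1 / 2 := by
    rw [Complex.normSq_ofReal, Real.mul_self_sqrt (by norm_num)]
  let x : ℂ → Fin q → ℂ := fun t c => (if c = a then s else 0) + (if c = b then t * s else 0)
  have hx : ∀ t, t ^ 2 = 1 → (starRingEnd ℂ) t = t → ∑ c, x t c * (starRingEnd ℂ) (x t c) = 1 := by
    intro t ht ht'
    simp only [x, map_add, apply_ite (starRingEnd ℂ), map_mul, hs', ht', map_zero, add_mul, mul_add,
      Finset.sum_add_distrib]
    simp [hab, hab.symm]
    linear_combination (1 + t ^ 2) * hs + ht / 2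
  have hx' : ∀ t, t ^ 2 = 1 → (starRingEnd ℂ) t = t → ∑ c, Complex.normSq (x t c) = 1 := by
    intro t ht ht'
    have := hx t ht ht'
    simp only [Complex.mul_conj] at this
    exact_mod_cast this
  have hxy : ∑ c, x 1 c * (starRingEnd ℂ) (x (-1) c) = 0 := by
    simp only [x, map_add, apply_ite (starRingEnd ℂ), map_mul, hs', map_neg, map_one, map_zero,
      add_mul, mul_add, Finset.sum_add_distrib]
    simp [hab, hab.symm]
  obtain ⟨W, hW, hWa, hWb⟩ := exists_unitary_two_columns hab (x 1) (x (-1))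
    (hx' _ (by simp) (by simp)) (hx' _ (by simp) (by simp)) hxy
  have h₁ := rowMoment_rotate hsupp hinv (i := i) hab hW hs hs' (t := 1) (by simp) (by simp) hWa
  have h₂ := rowMoment_rotate hsupp hinv (i := i) hab hW hs hs' (t := -1) (by simp) (by simp) hWb
  have h₃ : rowMoment μ i b b b b = rowMoment μ i a a a a := by
    linear_combination (h₂ - h₁) / 4
  exact ⟨h₃, by linear_combination -(h₁ + h₃) / 4⟩

theorem sum_conj_mul_self_row {U : Matrix (Fin q) (Fin q) ℂ}
    (hU : U ∈ Matrix.unitaryGroup (Fin q) ℂ) (i : Fin q) :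
    ∑ a, (starRingEnd ℂ) (U i a) * U i a = 1 := by
  have := congrFun (congrFun (mem_unitaryGroup_iff.1 hU) i) i
  simpa [Matrix.mul_apply, star_apply, mul_comm] using this

include hsupp hinv in
theorem rowMoment_eq (i a b c d : Fin q) :
    rowMoment μ i a b c d = ((if a = b then 1 else 0) * (if c = d then 1 else 0) +
      (if a = d then 1 else 0) * (if b = c then 1 else 0)) / ((q : ℂ) * ((q : ℂ) + 1)) := by
  obtain ⟨β, hβ⟩ : ∃ β : ℂ, ∀ a b c d, rowMoment μ i a b c d =
      ((if a = b then 1 else 0) * (if c = d then 1 else 0) +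
      (if a = d then 1 else 0) * (if b = c then 1 else 0)) * β := by
    refine ⟨rowMoment μ i i i i i / 2, fun a b c d => ?_⟩
    have hconst : ∀ a, rowMoment μ i a a a a = rowMoment μ i i i i i := by
      intro a
      by_cases h : i = a
      · rw [h]
      · exact (rowMoment_diagonal hsupp hinv h).1
    by_cases h₁ : a = b ∧ c = d
    · obtain ⟨rfl, rfl⟩ := h₁
      by_cases hac : a = c
      · subst hac
        rw [hconst, if_pos rfl]
        ring
      · rw [(rowMoment_diagonal hsupp hinv hac).2, hconst]
        simp [hac]
    · by_cases h₂ : a = d ∧ b = c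
      · obtain ⟨rfl, rfl⟩ := h₂
        have hab : a ≠ b := fun h => h₁ ⟨h, h.symm⟩
        rw [rowMoment_swap_right, (rowMoment_diagonal hsupp hinv hab).2, hconst]
        simp [hab]
      · rw [rowMoment_eq_zero hsupp hinv h₁ h₂]
        simp only [ite_zero_mul_ite_zero, if_neg h₁, if_neg h₂, add_zero, zero_mul]
  have hsum : ∑ a, ∑ c, rowMoment μ i a a c c = 1 := by
    have h : ∫ U : Matrix (Fin q) (Fin q) ℂ, ∑ a, ∑ c,
        (starRingEnd ℂ) (U i a) * U i a * ((starRingEnd ℂ) (U i c) * U i c) ∂μ = 1 := by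
      rw [integral_congr_ae (g := fun _ => (1 : ℂ))]
      · simp
      · filter_upwards [hsupp] with U hU
        rw [← Finset.sum_mul_sum, sum_conj_mul_self_row hU, one_mul]
    rw [← h, integral_finsetSum _ fun a _ => integrable_of_ae_unitary hsupp (by fun_prop)]
    refine Finset.sum_congr rfl fun a _ => ?_
    rw [integral_finsetSum _ fun a _ => integrable_of_ae_unitary hsupp (by fun_prop)]
    rfl
  have hq : (q : ℂ) * ((q : ℂ) + 1) * β = 1 := by
    refine Eq.trans ?_ hsum
    simp [hβ, add_mul, Finset.sum_add_distrib]
    ring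
  rw [hβ, eq_div_iff (left_ne_zero_of_mul_eq_one hq), mul_assoc, mul_comm β, hq, mul_one]

/-- The second-moment matrix of the `j`-th row, weighted by the quadratic form of `S` at the
`i`-th row. -/
def weightedMoment (μ : Measure (Matrix (Fin q) (Fin q) ℂ)) (S : Matrix (Fin q) (Fin q) ℂ)
    (i j a b : Fin q) : ℂ :=
  ∫ U, (∑ c, ∑ d, U i c * S c d * (starRingEnd ℂ) (U i d)) *
    ((starRingEnd ℂ) (U j a) * U j b) ∂μ

include hsupp hinv in
theorem weightedMoment_self {S : Matrix (Fin q) (Fin q) ℂ} (hS : S.trace = 0) (i a b : Fin q) :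
    weightedMoment μ S i i a b = S a b / ((q : ℂ) * ((q : ℂ) + 1)) := by
  have h : weightedMoment μ S i i a b = ∑ c, ∑ d, S c d * rowMoment μ i a b d c := by
    simp only [weightedMoment, rowMoment, Finset.sum_mul]
    rw [integral_finsetSum _ fun a _ => integrable_of_ae_unitary hsupp (by fun_prop)]
    refine Finset.sum_congr rfl fun c _ => ?_
    rw [integral_finsetSum _ fun a _ => integrable_of_ae_unitary hsupp (by fun_prop)]
    refine Finset.sum_congr rfl fun d _ => ?_
    rw [← integral_const_mul]
    congr 1
    ext U
    ring
  have htr : ∑ c, S c c = 0 := hS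
  simp only [h, rowMoment_eq hsupp hinv, ← mul_div_assoc, ← Finset.sum_div]
  congr 1
  simp only [mul_add, Finset.sum_add_distrib]
  simp [htr]

include hsupp hinv in
theorem sum_weightedMoment {S : Matrix (Fin q) (Fin q) ℂ} (hS : S.trace = 0) (i a b : Fin q) :
    ∑ j, weightedMoment μ S i j a b = 0 := by
  have hcol : ∀ U ∈ Matrix.unitaryGroup (Fin q) ℂ,
      ∑ j, (starRingEnd ℂ) (U j a) * U j b = if a = b then 1 else 0 := by
    intro U hU
    have := congrFun (congrFun (mem_unitaryGroup_iff'.1 hU) a) b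
    simpa [Matrix.mul_apply, star_apply, Matrix.one_apply] using this
  have htr : ∑ c, S c c = 0 := hS
  have hmean : ∑ c, weightedMoment μ S i i c c = 0 := by
    simp only [weightedMoment_self hsupp hinv hS, ← Finset.sum_div, htr, zero_div]
  have hsum : ∑ j, weightedMoment μ S i j a b =
      (if a = b then 1 else 0) * ∑ c, weightedMoment μ S i i c c := by
    simp only [weightedMoment]
    rw [← integral_finsetSum _ fun a _ => integrable_of_ae_unitary hsupp (by fun_prop),
      ← integral_finsetSum _ fun a _ => integrable_of_ae_unitary hsupp (by fun_prop),
      ← integral_const_mul]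
    refine integral_congr_ae ?_
    filter_upwards [hsupp] with U hU
    rw [← Finset.mul_sum, ← Finset.mul_sum, hcol U hU, sum_conj_mul_self_row hU]
    ring
  rw [hsum, hmean, mul_zero]

omit [IsProbabilityMeasure μ] in
include hinv in
theorem integral_eq_weightedMoment {x y : Fin q → ℂ} {S V : Matrix (Fin q) (Fin q) ℂ}
    (hV : V ∈ Matrix.unitaryGroup (Fin q) ℂ) {i j : Fin q} (hx : ∀ c, V c i = x c)
    (hy : ∀ c, V c j = y c) (a b : Fin q) :
    ∫ U : Matrix (Fin q) (Fin q) ℂ,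
      (∑ c, ∑ d, (starRingEnd ℂ) ((Uᴴ.mulVec x) c) * S c d * (Uᴴ.mulVec x) d) *
        ((Uᴴ.mulVec y) a * (starRingEnd ℂ) ((Uᴴ.mulVec y) b)) ∂μ = weightedMoment μ S i j a b := by
  rw [weightedMoment, ← integral_mul_left_unitary hinv (f := fun U =>
      (∑ c, ∑ d, U i c * S c d * (starRingEnd ℂ) (U i d)) *
        ((starRingEnd ℂ) (U j a) * U j b)) (by fun_prop)
    (show Vᴴ ∈ Matrix.unitaryGroup (Fin q) ℂ from Unitary.star_mem hV)]
  congr 1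
  ext U
  have hrow : ∀ (k : Fin q) (z : Fin q → ℂ), (∀ c, V c k = z c) → ∀ c,
      (Uᴴ.mulVec z) c = (starRingEnd ℂ) ((Vᴴ * U) k c) := by
    intro k z hz c
    simp [Matrix.mulVec, dotProduct, Matrix.mul_apply, hz, mul_comm]
  simp only [hrow i x hx, hrow j y hy, Complex.conj_conj]

end HaarMoments

/-- **Haar moments on the Stiefel manifold.** Let `φ, ψ` be orthonormal
vectors in `ℂ^q`, `S` a traceless Hermitian matrix, and `U` Haar-distributed on the unitary
group `U(q)` (formalized as: any Borel probability measure concentrated on the unitary group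
and invariant under left translation by every unitary — this characterizes Haar). Then,
entrywise, `E[⟨S(U*φ), U*φ⟩ (U*φ)(U*φ)*] = S/(q(q+1))` and
`E[⟨S(U*φ), U*φ⟩ (U*ψ)(U*ψ)*] = −S/(q(q+1)(q−1))`. -/
theorem haar_moment_stiefel
    (q : ℕ) (hq : 2 ≤ q)
    (φ ψ : Fin q → ℂ)
    (hφ : ∑ a, Complex.normSq (φ a) = 1)
    (hψ : ∑ a, Complex.normSq (ψ a) = 1)
    (horth : ∑ a, φ a * (starRingEnd ℂ) (ψ a) = 0)
    (S : Matrix (Fin q) (Fin q) ℂ) (hS : S.IsHermitian) (hStr : S.trace = 0)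
    (μ : Measure (Matrix (Fin q) (Fin q) ℂ))
    (hprob : IsProbabilityMeasure μ)
    (hsupp : μ {U : Matrix (Fin q) (Fin q) ℂ | U ∈ Matrix.unitaryGroup (Fin q) ℂ} = 1)
    (hinv : ∀ V ∈ Matrix.unitaryGroup (Fin q) ℂ,
        Measure.map (fun U => V * U) μ = μ) :
    (∀ a b : Fin q,
      (∫ U : Matrix (Fin q) (Fin q) ℂ,
          (∑ c, ∑ d, (starRingEnd ℂ) ((Uᴴ.mulVec φ) c) * S c d * (Uᴴ.mulVec φ) d) *
            ((Uᴴ.mulVec φ) a * (starRingEnd ℂ) ((Uᴴ.mulVec φ) b)) ∂μ)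
        = S a b / ((q : ℂ) * ((q : ℂ) + 1)))
    ∧
    (∀ a b : Fin q,
      (∫ U : Matrix (Fin q) (Fin q) ℂ,
          (∑ c, ∑ d, (starRingEnd ℂ) ((Uᴴ.mulVec φ) c) * S c d * (Uᴴ.mulVec φ) d) *
            ((Uᴴ.mulVec ψ) a * (starRingEnd ℂ) ((Uᴴ.mulVec ψ) b)) ∂μ)
        = -S a b / ((q : ℂ) * ((q : ℂ) + 1) * ((q : ℂ) - 1))) := by
  have hae : ∀ᵐ U ∂μ, U ∈ Matrix.unitaryGroup (Fin q) ℂ :=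
    (mem_ae_iff_prob_eq_one (isCompact_unitaryGroup q).measurableSet).2 hsupp
  let i : Fin q := ⟨0, by omega⟩
  have hcross : ∀ j, i ≠ j → ∀ a b : Fin q, ∫ U : Matrix (Fin q) (Fin q) ℂ,
      (∑ c, ∑ d, (starRingEnd ℂ) ((Uᴴ.mulVec φ) c) * S c d * (Uᴴ.mulVec φ) d) *
        ((Uᴴ.mulVec ψ) a * (starRingEnd ℂ) ((Uᴴ.mulVec ψ) b)) ∂μ = weightedMoment μ S i j a b := by
    intro j hij a b
    obtain ⟨V, hV, hVi, hVj⟩ := exists_unitary_two_columns hij φ ψ hφ hψ horth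
    exact integral_eq_weightedMoment hinv hV hVi hVj a b
  constructor
  · intro a b
    have h01 : i ≠ ⟨1, by omega⟩ := by simp [i]
    obtain ⟨V, hV, hVi, -⟩ := exists_unitary_two_columns h01 φ ψ hφ hψ horth
    rw [integral_eq_weightedMoment hinv hV hVi hVi, weightedMoment_self hae hinv hStr]
  · intro a b
    have hsum := sum_weightedMoment hae hinv hStr i a b
    rw [← Finset.add_sum_erase _ _ (Finset.mem_univ i), weightedMoment_self hae hinv hStr,
      Finset.sum_congr rfl fun j hj => (hcross j (Finset.ne_of_mem_erase hj).symm a b).symm,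
      Finset.sum_const, Finset.card_erase_of_mem (Finset.mem_univ i), Finset.card_univ,
      Fintype.card_fin, nsmul_eq_mul, Nat.cast_sub (by omega), Nat.cast_one] at hsum
    have hq1 : (q : ℂ) - 1 ≠ 0 := sub_ne_zero.2 (by exact_mod_cast (by omega : q ≠ 1))
    rw [← div_div, eq_div_iff hq1, neg_div]
    linear_combination hsum
end
end
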